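/- Assume Hypothesis (H2), let β ≥ 0, let C_HP > 0 be a constant such that ∫_0^1 v²/σ ≤ C_HP ∫_0^1 (v')² for all v ∈ H¹_{1/σ,0}(0,1), and let y be a classical solution of the damped degenerate wave equation. Set Θ := max{1/a(1) + K·C_HP/min_{[0,1]} η, 1 + K/4} and C₁ := (β²/η(1) + Kβ/2 + β/η(1) + K/4 + βε₀/2)·(1/(min_{[0,1]} η)³ + 1). Then for every δ ∈ (0, ε₀/(2C₁)) and every t > 0 one has E_y(t) ≤ E_y(0) e^{1 − t/M}, where M := (1/(ε₀ − 2δC₁))·[4Θ + 1/σ(1) + 1/η(1) + β/η(1) + K/4 + (β²/η(1) + Kβ/2 + β/η(1) + K/4 + βε₀/2)·(2 + 2C_HP/(min_{[0,1]} η)³ + 1/δ + (1/δ)(max_{[0,1]} η + C_HP)/(min_{[0,1]} η)²)]. In particular the energy decays exponentially. -/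

import Mathlib

open MeasureTheory Set Filter Topology

/-- The Feller weight `η(x) = exp (∫_{1/2}^x b/a)`. -/
noncomputable def etaW (a b : ℝ → ℝ) (x : ℝ) : ℝ :=
  Real.exp (∫ s in (1/2 : ℝ)..x, b s / a s)

/-- The weight `σ = a / η`. -/
noncomputable def sigW (a b : ℝ → ℝ) (x : ℝ) : ℝ :=
  a x / etaW a b x

/-- `u ∈ H¹(0,1)` with (a.e.) derivative `u'`. -/
structure MemH1 (u u' : ℝ → ℝ) : Prop where
  cont : ContinuousOn u (Set.Icc 0 1)
  hasDeriv : ∀ᵐ x ∂(volume.restrict (Set.Ioo (0:ℝ) 1)), HasDerivAt u (u' x) x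
  deriv_sq_int : IntegrableOn (fun x => (u' x) ^ 2) (Set.Ioo (0:ℝ) 1)
  ftc : ∀ x ∈ Set.Icc (0:ℝ) 1, u x = u 0 + ∫ t in Set.Ioo (0:ℝ) x, u' t

/-- `u ∈ L²_{1/σ}(0,1)`. -/
def MemL2sig (a b u : ℝ → ℝ) : Prop :=
  IntegrableOn (fun x => (u x) ^ 2) (Set.Ioo (0:ℝ) 1) ∧
  IntegrableOn (fun x => (u x) ^ 2 / sigW a b x) (Set.Ioo (0:ℝ) 1)

/-- `u ∈ H¹_{1/σ}(0,1)`. -/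
structure MemH1sig (a b u u' : ℝ → ℝ) extends MemH1 u u' : Prop where
  l2sig : MemL2sig a b u

/-- `u ∈ H¹_{1/σ,0}(0,1)`. -/
structure MemH1sig0 (a b u u' : ℝ → ℝ) extends MemH1sig a b u u' : Prop where
  zero : u 0 = 0

/-- `u ∈ H²_{1/σ}(0,1)`: `η u'` is locally absolutely continuous on `(0,1]`
with derivative `w`, and `Au = σ (η u')' = σ w ∈ L²_{1/σ}`. -/
structure MemH2sig (a b u u' w : ℝ → ℝ) extends MemH1sig a b u u' : Prop where
  w_locint : ∀ c ∈ Set.Ioc (0:ℝ) 1, IntegrableOn w (Set.Icc c 1)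
  locAC : ∀ c ∈ Set.Ioc (0:ℝ) 1, ∀ x ∈ Set.Icc c 1,
    etaW a b x * u' x = etaW a b c * u' c + ∫ t in Set.Ioo c x, w t
  Au_l2sig : MemL2sig a b (fun x => sigW a b x * w x)

/-- `u ∈ H²_{1/σ,0}(0,1)`. -/
structure MemH2sig0 (a b u u' w : ℝ → ℝ) extends MemH2sig a b u u' w : Prop where
  zero : u 0 = 0

/-- Hypothesis (H0): there is `K > 0` such that `x ↦ x^K / a x` is nondecreasing
in a right neighborhood of `0`. -/
def HypH0K (a : ℝ → ℝ) (K : ℝ) : Prop :=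
  0 < K ∧ ∃ ε > (0:ℝ), ∀ x y : ℝ, 0 < x → x ≤ y → y ≤ ε →
    x ^ K / a x ≤ y ^ K / a y

def HypH0 (a : ℝ → ℝ) : Prop := ∃ K : ℝ, HypH0K a K

/-- `a` is weakly degenerate at `0` with constant
`K = sup_{x ∈ (0,1]} x|a'(x)|/a(x) ∈ (0,1)`. -/
def IsWD (a a' : ℝ → ℝ) (K : ℝ) : Prop :=
  ContinuousOn a (Set.Icc 0 1) ∧ a 0 = 0 ∧ (∀ x ∈ Set.Ioc (0:ℝ) 1, 0 < a x) ∧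
  (∀ x ∈ Set.Ioc (0:ℝ) 1, HasDerivAt a (a' x) x) ∧
  ContinuousOn a' (Set.Ioc 0 1) ∧
  IsLUB ((fun x => x * |a' x| / a x) '' Set.Ioc (0:ℝ) 1) K ∧ 0 < K ∧ K < 1

/-- `a` is strongly degenerate at `0` with constant
`K = sup_{x ∈ (0,1]} x|a'(x)|/a(x) ∈ [1,2)`. -/
def IsSD (a a' : ℝ → ℝ) (K : ℝ) : Prop :=
  ContinuousOn a (Set.Icc 0 1) ∧ a 0 = 0 ∧ (∀ x ∈ Set.Ioc (0:ℝ) 1, 0 < a x) ∧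
  (∀ x ∈ Set.Icc (0:ℝ) 1, HasDerivWithinAt a (a' x) (Set.Icc 0 1) x) ∧
  ContinuousOn a' (Set.Icc 0 1) ∧
  IsLUB ((fun x => x * |a' x| / a x) '' Set.Ioc (0:ℝ) 1) K ∧ 1 ≤ K ∧ K < 2

/-- Hypothesis (H1): `b/a ∈ L¹(0,1)`, `b` continuous, `a` is (WD) or (SD) with
constant `K`, and if `K > 1` then `x b(x)/a(x) ∈ L^∞(0,1)`. -/
def HypH1 (a a' b : ℝ → ℝ) (K : ℝ) : Prop :=
  (IsWD a a' K ∨ IsSD a a' K) ∧ ContinuousOn b (Set.Icc 0 1) ∧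
  MeasureTheory.IntegrableOn (fun x => b x / a x) (Set.Ioo (0:ℝ) 1) ∧
  (1 < K → ∃ M : ℝ, ∀ x ∈ Set.Ioo (0:ℝ) 1, |x * b x / a x| ≤ M)

/-- Hypothesis (H2): (H1) and `(2-K) a(x) - 2x|b(x)| ≥ ε₀ a(x)` on `[0,1]`. -/
def HypH2 (a a' b : ℝ → ℝ) (K ε₀ : ℝ) : Prop :=
  HypH1 a a' b K ∧ 0 < ε₀ ∧
  ∀ x ∈ Set.Icc (0:ℝ) 1, ε₀ * a x ≤ (2 - K) * a x - 2 * x * |b x|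

/-- A classical solution of the damped degenerate wave equation
`y_tt = a y_xx + b y_x`, `y(t,0) = 0`, `y_t(t,1) + η(1) y_x(t,1) + β y(t,1) = 0`,
with the regularity, integrability and differentiation-under-the-integral
properties required of classical solutions. -/
structure ClassicalSol (a b : ℝ → ℝ) (β : ℝ)
    (y yt yx ytt ytx yxx : ℝ → ℝ → ℝ) : Prop where
  dt : ∀ t x, 0 ≤ t → x ∈ Set.Icc (0:ℝ) 1 → HasDerivAt (fun s => y s x) (yt t x) t
  dtt : ∀ t x, 0 ≤ t → x ∈ Set.Icc (0:ℝ) 1 → HasDerivAt (fun s => yt s x) (ytt t x) t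
  dx : ∀ t x, 0 ≤ t → x ∈ Set.Ioc (0:ℝ) 1 → HasDerivAt (fun ξ => y t ξ) (yx t x) x
  dtx : ∀ t x, 0 ≤ t → x ∈ Set.Ioc (0:ℝ) 1 → HasDerivAt (fun ξ => yt t ξ) (ytx t x) x
  dxx : ∀ t x, 0 ≤ t → x ∈ Set.Ioc (0:ℝ) 1 → HasDerivAt (fun ξ => yx t ξ) (yxx t x) x
  cont_tt : ContinuousOn (Function.uncurry ytt) (Set.Ici 0 ×ˢ Set.Ioc (0:ℝ) 1)
  cont_tx : ContinuousOn (Function.uncurry ytx) (Set.Ici 0 ×ˢ Set.Ioc (0:ℝ) 1)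
  cont_xx : ContinuousOn (Function.uncurry yxx) (Set.Ici 0 ×ˢ Set.Ioc (0:ℝ) 1)
  pde : ∀ t x, 0 < t → x ∈ Set.Ioo (0:ℝ) 1 → ytt t x = a x * yxx t x + b x * yx t x
  bc0 : ∀ t, 0 ≤ t → y t 0 = 0
  bc1 : ∀ t, 0 < t → yt t 1 + etaW a b 1 * yx t 1 + β * y t 1 = 0
  regx : ∀ t, 0 ≤ t → MemH2sig0 a b (y t) (yx t)
    (fun x => etaW a b x * (b x / a x * yx t x + yxx t x))
  regt : ∀ t, 0 ≤ t → MemH1sig0 a b (yt t) (ytx t)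
  ediff : ∀ t, 0 ≤ t → HasDerivAt
    (fun s => ∫ x in Set.Ioo (0:ℝ) 1,
      ((yt s x) ^ 2 / sigW a b x + etaW a b x * (yx s x) ^ 2))
    (∫ x in Set.Ioo (0:ℝ) 1,
      (2 * yt t x * ytt t x / sigW a b x + 2 * etaW a b x * yx t x * ytx t x)) t
  intQ : ∀ s T : ℝ, 0 < s → s < T →
    MeasureTheory.IntegrableOn
      (fun p : ℝ × ℝ => (yt p.1 p.2) ^ 2 / sigW a b p.2)
      (Set.Ioo s T ×ˢ Set.Ioo (0:ℝ) 1) ∧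
    MeasureTheory.IntegrableOn
      (fun p : ℝ × ℝ => etaW a b p.2 * (yx p.1 p.2) ^ 2)
      (Set.Ioo s T ×ˢ Set.Ioo (0:ℝ) 1)
  intBdry : ∀ s T : ℝ, 0 < s → s < T →
    MeasureTheory.IntegrableOn (fun t => (yt t 1) ^ 2) (Set.Ioo s T) ∧
    MeasureTheory.IntegrableOn (fun t => (yx t 1) ^ 2) (Set.Ioo s T) ∧
    MeasureTheory.IntegrableOn (fun t => (y t 1) ^ 2) (Set.Ioo s T)

/-- The energy of a solution `y`:
`E_y(t) = (1/2) [∫₀¹ (y_t²/σ + η y_x²) dx + β y(t,1)²]`. -/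
noncomputable def energy (a b : ℝ → ℝ) (β : ℝ) (y yt yx : ℝ → ℝ → ℝ) (t : ℝ) : ℝ :=
  (1/2) * ((∫ x in Set.Ioo (0:ℝ) 1,
    ((yt t x) ^ 2 / sigW a b x + etaW a b x * (yx t x) ^ 2)) + β * (y t 1) ^ 2)

/-! ### Real analysis on intervals -/

lemma setIntegral_Ioo_eq_intervalIntegral {f : ℝ → ℝ} {x y : ℝ} (h : x ≤ y) :
    ∫ t in Ioo x y, f t = ∫ t in x..y, f t := by
  rw [intervalIntegral.integral_of_le h, integral_Ioc_eq_integral_Ioo]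

lemma intervalIntegrable_of_Ioo {f : ℝ → ℝ} {x y : ℝ} (h : x ≤ y)
    (hf : IntegrableOn f (Ioo x y)) : IntervalIntegrable f volume x y :=
  (intervalIntegrable_iff_integrableOn_Ioo_of_le h).2 hf

lemma setIntegral_Ioo_add {f : ℝ → ℝ} {x : ℝ} (hx : x ∈ Ioo (0 : ℝ) 1)
    (hf : IntegrableOn f (Ioo 0 1)) :
    (∫ t in Ioo 0 x, f t) + ∫ t in Ioo x 1, f t = ∫ t in Ioo 0 1, f t := by
  rw [setIntegral_Ioo_eq_intervalIntegral hx.1.le, setIntegral_Ioo_eq_intervalIntegral hx.2.le,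
    setIntegral_Ioo_eq_intervalIntegral zero_le_one]
  exact intervalIntegral.integral_add_adjacent_intervals
    (intervalIntegrable_of_Ioo hx.1.le (hf.mono_set (Ioo_subset_Ioo le_rfl hx.2.le)))
    (intervalIntegrable_of_Ioo hx.2.le (hf.mono_set (Ioo_subset_Ioo hx.1.le le_rfl)))

lemma tendsto_setIntegral_Ioo_zero {f : ℝ → ℝ} (hf : IntegrableOn f (Ioo 0 1)) :
    Tendsto (fun x => ∫ t in Ioo 0 x, f t) (𝓝[>] (0 : ℝ)) (𝓝 0) := by
  have hc := intervalIntegral.continuousOn_primitive_interval'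
    (intervalIntegrable_of_Ioo zero_le_one hf) (left_mem_uIcc : (0 : ℝ) ∈ uIcc 0 1)
  have h0 := hc 0 left_mem_uIcc
  rw [uIcc_of_le zero_le_one, ContinuousWithinAt, intervalIntegral.integral_same] at h0
  have h1 : 𝓝[>] (0 : ℝ) ≤ 𝓝[Icc 0 1] 0 := by
    rw [← nhdsWithin_Ioo_eq_nhdsGT (zero_lt_one (α := ℝ))]
    exact nhdsWithin_mono _ Ioo_subset_Icc_self
  refine (h0.mono_left h1).congr' ?_
  filter_upwards [self_mem_nhdsWithin] with x hx
  exact (setIntegral_Ioo_eq_intervalIntegral (le_of_lt hx)).symm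

lemma integrableOn_of_sq {f : ℝ → ℝ} {x y : ℝ}
    (hm : AEStronglyMeasurable f (volume.restrict (Ioo x y)))
    (hf : IntegrableOn (fun t => f t ^ 2) (Ioo x y)) : IntegrableOn f (Ioo x y) := by
  have h1 : IntegrableOn (fun t => f t ^ 2 + 1) (Ioo x y) := hf.add (by simp)
  refine Integrable.mono' h1 hm (Eventually.of_forall fun t => ?_)
  rw [Real.norm_eq_abs, abs_le]
  constructor <;> nlinarith [sq_nonneg (f t - 1), sq_nonneg (f t + 1)]

lemma sq_setIntegral_Ioo_le {f : ℝ → ℝ} {x : ℝ} (hx : 0 ≤ x) (hf : IntegrableOn f (Ioo 0 x))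
    (hf2 : IntegrableOn (fun t => f t ^ 2) (Ioo 0 x)) :
    (∫ t in Ioo 0 x, f t) ^ 2 ≤ x * ∫ t in Ioo 0 x, f t ^ 2 := by
  have key : ∀ c : ℝ, 0 ≤ (∫ t in Ioo 0 x, f t ^ 2) - 2 * c * (∫ t in Ioo 0 x, f t)
      + c ^ 2 * x := by
    intro c
    have h0 : 0 ≤ ∫ t in Ioo 0 x, (f t - c) ^ 2 := integral_nonneg fun _ => sq_nonneg _
    have h1 : ∫ t in Ioo 0 x, (f t - c) ^ 2
        = ∫ t in Ioo 0 x, ((f t ^ 2 - 2 * c * f t) + c ^ 2) := by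
      congr 1; ext t; ring
    have h2 : IntegrableOn (fun _ : ℝ => c ^ 2) (Ioo 0 x) := by simp
    have h3 : IntegrableOn (fun t => f t ^ 2 - 2 * c * f t) (Ioo 0 x) := hf2.sub (hf.const_mul _)
    rw [h1, integral_add h3 h2, integral_sub hf2 (hf.const_mul _),
      integral_const_mul] at h0
    simpa [hx, mul_comm] using h0
  rcases hx.eq_or_lt with rfl | hx
  · simp
  · have h := key ((∫ t in Ioo 0 x, f t) / x)
    have h' : 0 ≤ x * ((∫ t in Ioo 0 x, f t ^ 2)
      - 2 * ((∫ t in Ioo 0 x, f t) / x) * (∫ t in Ioo 0 x, f t)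
      + ((∫ t in Ioo 0 x, f t) / x) ^ 2 * x) := mul_nonneg hx.le h
    field_simp at h'
    nlinarith

lemma frequently_mul_lt {g : ℝ → ℝ} (hg : IntegrableOn g (Ioo 0 1)) {P : ℝ → Prop}
    (hP : ∀ᵐ x ∂(volume.restrict (Ioo (0 : ℝ) 1)), P x) {τ : ℝ} (hτ : 0 < τ) :
    ∃ᶠ x in 𝓝[>] (0 : ℝ), P x ∧ x * g x < τ := by
  intro hev
  obtain ⟨r, hr0, hr⟩ := mem_nhdsGT_iff_exists_Ioo_subset.1 hev
  have hr0 : (0 : ℝ) < r := hr0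
  set ρ := min r 1 with hρ
  have hρ0 : 0 < ρ := lt_min hr0 one_pos
  have hsub : Ioo 0 ρ ⊆ Ioo (0 : ℝ) 1 := Ioo_subset_Ioo le_rfl (min_le_right _ _)
  have hP' : ∀ᵐ x ∂(volume.restrict (Ioo (0 : ℝ) ρ)), P x :=
    ae_mono (Measure.restrict_mono hsub le_rfl) hP
  have hint : IntegrableOn (fun x : ℝ => x ^ (-1 : ℝ)) (Ioo 0 ρ) := by
    refine Integrable.mono' ((hg.mono_set hsub).const_mul τ⁻¹) ?_ ?_
    · exact (measurable_id.pow_const _).aestronglyMeasurable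
    · filter_upwards [hP', ae_restrict_mem measurableSet_Ioo] with x hx hxm
      have h1 : ¬ (P x ∧ x * g x < τ) := hr ⟨hxm.1, hxm.2.trans_le (min_le_left _ _)⟩
      have h2 : τ ≤ x * g x := by
        by_contra h; exact h1 ⟨hx, not_le.1 h⟩
      rw [Real.rpow_neg_one, Real.norm_eq_abs, abs_of_pos (inv_pos.2 hxm.1)]
      have hx0 := hxm.1
      rw [inv_mul_eq_div, le_div_iff₀ hτ, inv_mul_le_iff₀ hx0]
      exact h2
  exact absurd ((intervalIntegral.integrableOn_Ioo_rpow_iff hρ0).1 hint) (lt_irrefl _)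

/-- The integral form of Grönwall's lemma behind Komornik's decay estimate. -/
lemma decay_of_integral_le {E : ℝ → ℝ} {M : ℝ} (hM : 0 < M) (hc : ContinuousOn E (Ici 0))
    (hanti : AntitoneOn E (Ici 0)) (h0 : ∀ t, 0 ≤ t → 0 ≤ E t)
    (hint : ∀ s T, 0 < s → s < T → ∫ t in s..T, E t ≤ M * E s) {t : ℝ} (ht : 0 < t) :
    E t ≤ E 0 * Real.exp (1 - t / M) := by
  rcases le_or_gt t M with htM | htM
  · calc E t ≤ E 0 := hanti (by simp) ht.le ht.le
      _ ≤ E 0 * Real.exp (1 - t / M) := by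
        refine le_mul_of_one_le_right (h0 0 le_rfl) (Real.one_le_exp ?_)
        rw [sub_nonneg, div_le_one hM]; exact htM
  · have hci : ∀ s ∈ Icc 0 t, ContinuousOn E (uIcc s t) := fun s hs =>
      hc.mono (by rw [uIcc_of_le hs.2]; exact fun x hx => hs.1.trans hx.1)
    have hii : IntervalIntegrable E volume 0 t := (hci 0 ⟨le_rfl, ht.le⟩).intervalIntegrable
    set J : ℝ → ℝ := fun s => ∫ r in s..t, E r with hJ
    have hJc : ContinuousOn J (Icc 0 t) := by
      have := intervalIntegral.continuousOn_primitive_interval' hii.symm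
        (left_mem_uIcc : t ∈ uIcc t 0)
      rw [uIcc_of_ge ht.le] at this
      refine this.neg.congr fun s _ => ?_
      simp only [hJ]
      exact intervalIntegral.integral_symm _ _
    have hJd : ∀ s ∈ Ioo 0 t, HasDerivAt J (-E s) s := by
      intro s hs
      have hcs : ContinuousAt E s := (hc s hs.1.le).continuousAt (Ici_mem_nhds hs.1)
      refine intervalIntegral.integral_hasDerivAt_left
        ((hci s ⟨hs.1.le, hs.2.le⟩).intervalIntegrable) ?_ hcs
      exact ContinuousOn.stronglyMeasurableAtFilter isOpen_Ioo
        (hc.mono (fun x hx => le_of_lt hx.1) : ContinuousOn E (Ioo 0 t)) s hs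
    have hJM : ∀ s ∈ Ioo 0 t, J s ≤ M * E s := fun s hs => hint s t hs.1 hs.2
    have hanti2 : AntitoneOn (fun s => J s * Real.exp (s / M)) (Icc 0 t) := by
      have hd : ∀ s ∈ Ioo 0 t, HasDerivAt (fun s => J s * Real.exp (s / M))
          (-E s * Real.exp (s / M) + J s * (Real.exp (s / M) * (1 / M))) s := by
        intro s hs
        exact (hJd s hs).mul (((hasDerivAt_id s).div_const M).exp)
      refine antitoneOn_of_deriv_nonpos (convex_Icc 0 t) (hJc.mul (by fun_prop)) ?_ ?_
      · rw [interior_Icc]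
        exact fun s hs => (hd s hs).differentiableAt.differentiableWithinAt
      · rw [interior_Icc]
        intro s hs
        rw [(hd s hs).deriv]
        have h1 : J s * (1 / M) ≤ E s := by
          rw [mul_one_div, div_le_iff₀ hM, mul_comm]; exact hJM s hs
        have h2 := Real.exp_pos (s / M)
        nlinarith [mul_le_mul_of_nonneg_right h1 h2.le]
    have hJ0 : J 0 ≤ M * E 0 := by
      have hev : ∀ᶠ s in 𝓝[>] (0 : ℝ), J s ≤ M * E s := by
        filter_upwards [Ioo_mem_nhdsGT ht] with s hs using hJM s hs
      have hl : 𝓝[>] (0 : ℝ) ≤ 𝓝[Icc 0 t] 0 := by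
        rw [← nhdsWithin_Ioo_eq_nhdsGT ht]
        exact nhdsWithin_mono _ Ioo_subset_Icc_self
      have hl2 : 𝓝[>] (0 : ℝ) ≤ 𝓝[Ici 0] 0 := nhdsWithin_mono _ Ioi_subset_Ici_self
      have t1 : Tendsto J (𝓝[>] 0) (𝓝 (J 0)) := (hJc 0 ⟨le_rfl, ht.le⟩).mono_left hl
      have t2 : Tendsto E (𝓝[>] 0) (𝓝 (E 0)) := (hc 0 (by simp)).mono_left hl2
      exact le_of_tendsto_of_tendsto t1 (t2.const_mul M) hev
    have h3 : J (t - M) * Real.exp ((t - M) / M) ≤ J 0 * Real.exp (0 / M) :=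
      hanti2 ⟨le_rfl, ht.le⟩ ⟨by linarith, by linarith⟩ (by linarith)
    have h4 : M * E t ≤ J (t - M) := by
      have : ∫ _ in (t - M)..t, E t ≤ J (t - M) := by
        refine intervalIntegral.integral_mono_on (by linarith) (by simp)
          (hci (t - M) ⟨by linarith, by linarith⟩).intervalIntegrable fun x hx => ?_
        exact hanti (show (0 : ℝ) ≤ x by linarith [hx.1]) ht.le hx.2
      simpa using this
    have h5 : Real.exp (1 - t / M) * Real.exp ((t - M) / M) = 1 := by
      rw [← Real.exp_add]
      have : 1 - t / M + (t - M) / M = 0 := by field_simp; ring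
      rw [this, Real.exp_zero]
    rw [zero_div, Real.exp_zero, mul_one] at h3
    have h6 : E t * Real.exp ((t - M) / M) ≤ E 0 := by
      have : M * (E t * Real.exp ((t - M) / M)) ≤ M * E 0 := by
        nlinarith [mul_le_mul_of_nonneg_right h4 (Real.exp_pos ((t - M) / M)).le]
      exact le_of_mul_le_mul_left this hM
    calc E t = E t * Real.exp ((t - M) / M) * Real.exp (1 - t / M) := by
          rw [mul_assoc, mul_comm (Real.exp ((t - M) / M)), h5, mul_one]
      _ ≤ _ := mul_le_mul_of_nonneg_right h6 (Real.exp_pos _).le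

/-! ### The coefficients -/

lemma etaW_pos (a b : ℝ → ℝ) (x : ℝ) : 0 < etaW a b x := Real.exp_pos _

section Coefficients

variable {a a' b : ℝ → ℝ} {K : ℝ}

lemma HypH1.pos (h : HypH1 a a' b K) : ∀ x ∈ Ioc (0 : ℝ) 1, 0 < a x := by
  rcases h.1 with h | h
  · exact h.2.2.1
  · exact h.2.2.1

lemma HypH1.continuousOn (h : HypH1 a a' b K) : ContinuousOn a (Icc 0 1) := by
  rcases h.1 with h | h
  · exact h.1
  · exact h.1

lemma HypH1.hasDerivAt (h : HypH1 a a' b K) {x : ℝ} (hx : x ∈ Ioo (0 : ℝ) 1) :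
    HasDerivAt a (a' x) x := by
  rcases h.1 with h | h
  · exact h.2.2.2.1 x ⟨hx.1, hx.2.le⟩
  · exact (h.2.2.2.1 x ⟨hx.1.le, hx.2.le⟩).hasDerivAt (Icc_mem_nhds hx.1 hx.2)

lemma HypH1.K_mem (h : HypH1 a a' b K) : K ∈ Ioo (0 : ℝ) 2 := by
  rcases h.1 with h | h
  · exact ⟨h.2.2.2.2.2.2.1, h.2.2.2.2.2.2.2.trans one_lt_two⟩
  · exact ⟨one_pos.trans_le h.2.2.2.2.2.2.1, h.2.2.2.2.2.2.2⟩

lemma HypH1.mul_abs_deriv_le (h : HypH1 a a' b K) {x : ℝ} (hx : x ∈ Ioc (0 : ℝ) 1) :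
    x * |a' x| ≤ K * a x := by
  have hl : IsLUB ((fun x => x * |a' x| / a x) '' Ioc (0 : ℝ) 1) K := by
    rcases h.1 with h | h
    · exact h.2.2.2.2.2.1
    · exact h.2.2.2.2.2.1
  have := hl.1 (mem_image_of_mem _ hx)
  exact (div_le_iff₀ (h.pos x hx)).1 this

lemma HypH1.sq_mul_le (h : HypH1 a a' b K) {x : ℝ} (hx : x ∈ Ioc (0 : ℝ) 1) :
    x ^ 2 / a x ≤ 1 / a 1 := by
  have hd : ∀ z ∈ Ioo (0 : ℝ) 1, HasDerivAt (fun z => z ^ 2 / a z)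
      (((2 : ℕ) * z ^ (2 - 1) * a z - z ^ 2 * a' z) / a z ^ 2) z := fun z hz =>
    (hasDerivAt_pow 2 z).div (h.hasDerivAt hz) (h.pos z ⟨hz.1, hz.2.le⟩).ne'
  have hm : MonotoneOn (fun z => z ^ 2 / a z) (Ioc 0 1) := by
    refine monotoneOn_of_deriv_nonneg (convex_Ioc 0 1) ?_ ?_ ?_
    · exact ContinuousOn.div (by fun_prop) (h.continuousOn.mono Ioc_subset_Icc_self)
        fun z hz => (h.pos z hz).ne'
    · rw [interior_Ioc]
      exact fun z hz => (hd z hz).differentiableAt.differentiableWithinAt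
    · rw [interior_Ioc]
      intro z hz
      rw [(hd z hz).deriv]
      have hz' : z ∈ Ioc (0 : ℝ) 1 := ⟨hz.1, hz.2.le⟩
      have h1 := h.mul_abs_deriv_le hz'
      have h2 := h.pos z hz'
      have h3 := le_abs_self (a' z)
      have h4 := h.K_mem.2
      have h5 : z * a' z ≤ 2 * a z := by nlinarith [mul_le_mul_of_nonneg_left h3 hz.1.le]
      refine div_nonneg ?_ (sq_nonneg _)
      push_cast
      nlinarith [mul_le_mul_of_nonneg_left h5 hz.1.le]
  simpa using hm hx ⟨zero_lt_one, le_rfl⟩ hx.2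

lemma HypH1.div_intervalIntegrable (h : HypH1 a a' b K) :
    IntervalIntegrable (fun x => b x / a x) volume 0 1 :=
  intervalIntegrable_of_Ioo zero_le_one h.2.2.1

lemma HypH1.etaW_continuousOn (h : HypH1 a a' b K) : ContinuousOn (etaW a b) (Icc 0 1) := by
  have := intervalIntegral.continuousOn_primitive_interval' h.div_intervalIntegrable
    (show (1 / 2 : ℝ) ∈ uIcc 0 1 by rw [uIcc_of_le zero_le_one]; constructor <;> norm_num)
  rw [uIcc_of_le zero_le_one] at this
  exact this.rexp

lemma HypH1.etaW_hasDerivAt (h : HypH1 a a' b K) {x : ℝ} (hx : x ∈ Ioo (0 : ℝ) 1) :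
    HasDerivAt (etaW a b) (etaW a b x * (b x / a x)) x := by
  have hc : ContinuousOn (fun x => b x / a x) (Ioo 0 1) :=
    (h.2.1.mono Ioo_subset_Icc_self).div (h.continuousOn.mono Ioo_subset_Icc_self)
      fun z hz => (h.pos z ⟨hz.1, hz.2.le⟩).ne'
  refine (intervalIntegral.integral_hasDerivAt_right ?_
    (hc.stronglyMeasurableAtFilter isOpen_Ioo x hx)
    (hc.continuousAt (isOpen_Ioo.mem_nhds hx))).exp
  refine h.div_intervalIntegrable.mono_set ?_
  rw [uIcc_of_le (zero_le_one (α := ℝ))]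
  exact uIcc_subset_Icc ⟨by norm_num, by norm_num⟩ ⟨hx.1.le, hx.2.le⟩

lemma HypH1.sigW_pos (h : HypH1 a a' b K) {x : ℝ} (hx : x ∈ Ioc (0 : ℝ) 1) : 0 < sigW a b x :=
  div_pos (h.pos x hx) (etaW_pos a b x)

lemma HypH1.sigW_continuousOn (h : HypH1 a a' b K) : ContinuousOn (sigW a b) (Icc 0 1) :=
  h.continuousOn.div h.etaW_continuousOn fun x _ => (etaW_pos a b x).ne'

lemma HypH1.sigW_hasDerivAt (h : HypH1 a a' b K) {x : ℝ} (hx : x ∈ Ioo (0 : ℝ) 1) :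
    HasDerivAt (sigW a b) ((a' x - b x) / etaW a b x) x := by
  have hx' : x ∈ Ioc (0 : ℝ) 1 := ⟨hx.1, hx.2.le⟩
  have h1 := (h.hasDerivAt hx).div (h.etaW_hasDerivAt hx) (etaW_pos a b x).ne'
  refine h1.congr_deriv ?_
  have := (h.pos x hx').ne'
  have := (etaW_pos a b x).ne'
  field_simp

/-- Two-sided bounds for the weight `η`. -/
lemma HypH1.sInf_etaW (h : HypH1 a a' b K) :
    0 < sInf (etaW a b '' Icc 0 1) ∧
      ∀ x ∈ Icc (0 : ℝ) 1, sInf (etaW a b '' Icc 0 1) ≤ etaW a b x := by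
  have hne : (Icc (0 : ℝ) 1).Nonempty := nonempty_Icc.2 zero_le_one
  obtain ⟨x, -, hx2, hx3⟩ := isCompact_Icc.exists_sInf_image_eq_and_le hne h.etaW_continuousOn
  rw [hx2]
  exact ⟨etaW_pos a b x, hx3⟩

lemma HypH1.le_sSup_etaW (h : HypH1 a a' b K) {x : ℝ} (hx : x ∈ Icc (0 : ℝ) 1) :
    etaW a b x ≤ sSup (etaW a b '' Icc 0 1) :=
  le_csSup (isCompact_Icc.image_of_continuousOn h.etaW_continuousOn).bddAbove
    (mem_image_of_mem _ hx)

/-- The profile `Z(x) = ∫₀ˣ 1/η` solving `(η Z')' = 0`, `Z(0) = 0`. -/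
noncomputable def profile (a b : ℝ → ℝ) (x : ℝ) : ℝ := ∫ s in (0 : ℝ)..x, (etaW a b s)⁻¹

lemma HypH1.etaW_inv_continuousOn (h : HypH1 a a' b K) :
    ContinuousOn (fun x => (etaW a b x)⁻¹) (Icc 0 1) :=
  h.etaW_continuousOn.inv₀ fun x _ => (etaW_pos a b x).ne'

lemma HypH1.profile_continuousOn (h : HypH1 a a' b K) :
    ContinuousOn (profile a b) (Icc 0 1) := by
  have h1 : IntervalIntegrable (fun x => (etaW a b x)⁻¹) volume 0 1 :=
    ContinuousOn.intervalIntegrable (by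
      rw [uIcc_of_le zero_le_one]; exact h.etaW_inv_continuousOn)
  have := intervalIntegral.continuousOn_primitive_interval' h1 left_mem_uIcc
  rwa [uIcc_of_le zero_le_one] at this

lemma HypH1.profile_hasDerivAt (h : HypH1 a a' b K) {x : ℝ} (hx : x ∈ Ioo (0 : ℝ) 1) :
    HasDerivAt (profile a b) (etaW a b x)⁻¹ x := by
  have hc := h.etaW_inv_continuousOn.mono Ioo_subset_Icc_self
  refine intervalIntegral.integral_hasDerivAt_right ?_
    (hc.stronglyMeasurableAtFilter isOpen_Ioo x hx)
    (hc.continuousAt (isOpen_Ioo.mem_nhds hx))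
  refine ContinuousOn.intervalIntegrable (h.etaW_inv_continuousOn.mono ?_)
  rw [uIcc_of_le hx.1.le]
  exact Icc_subset_Icc le_rfl hx.2.le

lemma HypH1.profile_mem (h : HypH1 a a' b K) {x : ℝ} (hx : x ∈ Icc (0 : ℝ) 1) :
    0 ≤ profile a b x ∧ profile a b x ≤ x / sInf (etaW a b '' Icc 0 1) := by
  refine ⟨intervalIntegral.integral_nonneg hx.1 fun s _ => (inv_pos.2 (etaW_pos a b s)).le, ?_⟩
  have h1 : profile a b x ≤ ∫ _ in (0 : ℝ)..x, (sInf (etaW a b '' Icc 0 1))⁻¹ := by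
    refine intervalIntegral.integral_mono_on hx.1 ?_ (by simp) fun s hs => ?_
    · refine ContinuousOn.intervalIntegrable (h.etaW_inv_continuousOn.mono ?_)
      rw [uIcc_of_le hx.1]
      exact Icc_subset_Icc le_rfl hx.2
    · exact inv_anti₀ h.sInf_etaW.1 (h.sInf_etaW.2 s ⟨hs.1, hs.2.trans hx.2⟩)
  simpa [div_eq_mul_inv] using h1

lemma HypH1.profile_sq_div_le (h : HypH1 a a' b K) {x : ℝ} (hx : x ∈ Ioc (0 : ℝ) 1) :
    profile a b x ^ 2 / sigW a b x ≤
      1 / a 1 * sSup (etaW a b '' Icc 0 1) / sInf (etaW a b '' Icc 0 1) ^ 2 := by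
  have hm := h.sInf_etaW.1
  have hx' := Ioc_subset_Icc_self hx
  have h1 : profile a b x ^ 2 ≤ (x / sInf (etaW a b '' Icc 0 1)) ^ 2 :=
    pow_le_pow_left₀ (h.profile_mem hx').1 (h.profile_mem hx').2 2
  have h2 := h.pos x hx
  calc profile a b x ^ 2 / sigW a b x
      ≤ (x / sInf (etaW a b '' Icc 0 1)) ^ 2 / sigW a b x :=
        div_le_div_of_nonneg_right h1 (h.sigW_pos hx).le
    _ = x ^ 2 / a x * etaW a b x / sInf (etaW a b '' Icc 0 1) ^ 2 := by
        rw [sigW]; field_simp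
    _ ≤ _ := by
        refine div_le_div_of_nonneg_right ?_ (sq_nonneg _)
        exact mul_le_mul (h.sq_mul_le hx) (h.le_sSup_etaW hx') (etaW_pos a b x).le
          (one_div_pos.2 (h.pos 1 ⟨one_pos, le_rfl⟩)).le

lemma integrableOn_Ioo_of_continuousOn_of_bound {f : ℝ → ℝ} {x y : ℝ} {C : ℝ}
    (hf : ContinuousOn f (Ioo x y)) (hC : ∀ t ∈ Ioo x y, |f t| ≤ C) :
    IntegrableOn f (Ioo x y) := by
  have hc : IntegrableOn (fun _ : ℝ => C) (Ioo x y) := by simp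
  refine Integrable.mono' hc (hf.aestronglyMeasurable measurableSet_Ioo) ?_
  filter_upwards [ae_restrict_mem measurableSet_Ioo] with t ht using hC t ht

lemma HypH1.profile_memH1sig0 (h : HypH1 a a' b K) :
    MemH1sig0 a b (profile a b) (fun x => (etaW a b x)⁻¹) where
  cont := h.profile_continuousOn
  hasDeriv := by
    filter_upwards [ae_restrict_mem measurableSet_Ioo] with x hx using h.profile_hasDerivAt hx
  deriv_sq_int := ((h.etaW_inv_continuousOn.pow 2).integrableOn_Icc).mono_set Ioo_subset_Icc_self
  ftc := by
    intro x hx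
    simp [profile, setIntegral_Ioo_eq_intervalIntegral hx.1]
  l2sig := by
    refine ⟨((h.profile_continuousOn.pow 2).integrableOn_Icc).mono_set Ioo_subset_Icc_self, ?_⟩
    refine integrableOn_Ioo_of_continuousOn_of_bound
      (C := 1 / a 1 * sSup (etaW a b '' Icc 0 1) / sInf (etaW a b '' Icc 0 1) ^ 2) ?_
      fun x hx => ?_
    · exact ((h.profile_continuousOn.pow 2).mono Ioo_subset_Icc_self).div
        (h.sigW_continuousOn.mono Ioo_subset_Icc_self)
        fun x hx => (h.sigW_pos ⟨hx.1, hx.2.le⟩).ne'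
    · have hx' : x ∈ Ioc (0 : ℝ) 1 := ⟨hx.1, hx.2.le⟩
      rw [abs_of_nonneg (div_nonneg (sq_nonneg _) (h.sigW_pos hx').le)]
      exact h.profile_sq_div_le hx'
  zero := by simp [profile]

lemma HypH1.integral_profile_sq_le (h : HypH1 a a' b K) {C : ℝ} (hC : 0 ≤ C)
    (hHP : ∀ v v' : ℝ → ℝ, MemH1sig0 a b v v' →
      ∫ x in Ioo (0 : ℝ) 1, (v x) ^ 2 / sigW a b x ≤ C * ∫ x in Ioo (0 : ℝ) 1, (v' x) ^ 2) :
    ∫ x in Ioo (0 : ℝ) 1, profile a b x ^ 2 / sigW a b x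
      ≤ C / sInf (etaW a b '' Icc 0 1) ^ 2 := by
  refine (hHP _ _ h.profile_memH1sig0).trans ?_
  rw [div_eq_mul_inv]
  refine mul_le_mul_of_nonneg_left ?_ hC
  have h1 : ∫ x in Ioo (0 : ℝ) 1, (etaW a b x)⁻¹ ^ 2
      ≤ ∫ _ in Ioo (0 : ℝ) 1, (sInf (etaW a b '' Icc 0 1) ^ 2)⁻¹ := by
    refine setIntegral_mono_on h.profile_memH1sig0.deriv_sq_int (by simp) measurableSet_Ioo ?_
    intro x hx
    rw [inv_pow]
    exact inv_anti₀ (pow_pos h.sInf_etaW.1 2)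
      (pow_le_pow_left₀ h.sInf_etaW.1.le (h.sInf_etaW.2 x (Ioo_subset_Icc_self hx)) 2)
  simpa using h1

end Coefficients

/-! ### Properties of classical solutions -/

section Solution

variable {a a' b : ℝ → ℝ} {K β : ℝ} {y yt yx ytt ytx yxx : ℝ → ℝ → ℝ}

lemma ContinuousOn.uncurry_slice {f : ℝ → ℝ → ℝ} {A B : Set ℝ}
    (hf : ContinuousOn (Function.uncurry f) (A ×ˢ B)) {t : ℝ} (ht : t ∈ A) :
    ContinuousOn (f t) B :=
  hf.comp (f := fun x => (t, x)) (by fun_prop) fun _ hx => ⟨ht, hx⟩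

lemma ClassicalSol.yx_continuousOn (hy : ClassicalSol a b β y yt yx ytt ytx yxx) {t : ℝ}
    (ht : 0 ≤ t) : ContinuousOn (yx t) (Ioc 0 1) :=
  fun x hx => (hy.dxx t x ht hx).continuousAt.continuousWithinAt

lemma ClassicalSol.yt_continuousOn (hy : ClassicalSol a b β y yt yx ytt ytx yxx) {t : ℝ}
    (ht : 0 ≤ t) : ContinuousOn (yt t) (Ioc 0 1) :=
  fun x hx => (hy.dtx t x ht hx).continuousAt.continuousWithinAt

lemma ClassicalSol.y_continuousOn (hy : ClassicalSol a b β y yt yx ytt ytx yxx) {t : ℝ}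
    (ht : 0 ≤ t) : ContinuousOn (y t) (Ioc 0 1) :=
  fun x hx => (hy.dx t x ht hx).continuousAt.continuousWithinAt

lemma HypH1.integrableOn_eta_mul (h : HypH1 a a' b K) {f : ℝ → ℝ}
    (hf : ContinuousOn f (Ioc 0 1)) (hf2 : IntegrableOn (fun x => f x ^ 2) (Ioo 0 1)) :
    IntegrableOn (fun x => etaW a b x * f x ^ 2) (Ioo 0 1) := by
  refine Integrable.mono' (hf2.const_mul (sSup (etaW a b '' Icc 0 1))) ?_ ?_
  · exact ((h.etaW_continuousOn.mono Ioo_subset_Icc_self).mul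
      ((hf.mono Ioo_subset_Ioc_self).pow 2)).aestronglyMeasurable measurableSet_Ioo
  · filter_upwards [ae_restrict_mem measurableSet_Ioo] with x hx
    rw [Real.norm_eq_abs, abs_of_nonneg (mul_nonneg (etaW_pos a b x).le (sq_nonneg _))]
    exact mul_le_mul_of_nonneg_right (h.le_sSup_etaW (Ioo_subset_Icc_self hx)) (sq_nonneg _)

lemma ClassicalSol.integrableOn_yt (hy : ClassicalSol a b β y yt yx ytt ytx yxx) {t : ℝ}
    (ht : 0 ≤ t) : IntegrableOn (fun x => yt t x ^ 2 / sigW a b x) (Ioo 0 1) :=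
  (hy.regt t ht).l2sig.2

lemma ClassicalSol.integrableOn_yx (hy : ClassicalSol a b β y yt yx ytt ytx yxx)
    (h : HypH1 a a' b K) {t : ℝ} (ht : 0 ≤ t) :
    IntegrableOn (fun x => etaW a b x * yx t x ^ 2) (Ioo 0 1) :=
  h.integrableOn_eta_mul (hy.yx_continuousOn ht) (hy.regx t ht).deriv_sq_int

lemma ClassicalSol.ytt_div_sigW (hy : ClassicalSol a b β y yt yx ytt ytx yxx)
    (h : HypH1 a a' b K) {t x : ℝ} (ht : 0 < t) (hx : x ∈ Ioo (0 : ℝ) 1) :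
    ytt t x / sigW a b x = etaW a b x * (b x / a x) * yx t x + etaW a b x * yxx t x := by
  have h1 := (h.pos x ⟨hx.1, hx.2.le⟩).ne'
  have h2 := (etaW_pos a b x).ne'
  rw [hy.pde t x ht hx, sigW]
  field_simp
  ring

lemma ClassicalSol.integrableOn_ytt (hy : ClassicalSol a b β y yt yx ytt ytx yxx)
    (h : HypH1 a a' b K) {t : ℝ} (ht : 0 < t) :
    IntegrableOn (fun x => ytt t x ^ 2 / sigW a b x) (Ioo 0 1) := by
  refine (hy.regx t ht.le).Au_l2sig.2.congr_fun (fun x hx => ?_) measurableSet_Ioo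
  have h1 := (h.pos x ⟨hx.1, hx.2.le⟩).ne'
  have h2 := (etaW_pos a b x).ne'
  have h3 : sigW a b x * (etaW a b x * (b x / a x * yx t x + yxx t x)) = ytt t x := by
    rw [hy.pde t x ht hx, sigW]
    field_simp
    ring
  simp only [h3]

lemma MemH1.sq_le {u u' : ℝ → ℝ} (hu : MemH1 u u') (h0 : u 0 = 0)
    (hc : ContinuousOn u' (Ioc 0 1)) {x : ℝ} (hx : x ∈ Icc (0 : ℝ) 1) :
    u x ^ 2 ≤ x * ∫ s in Ioo (0 : ℝ) 1, u' s ^ 2 := by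
  have hsub : Ioo 0 x ⊆ Ioo (0 : ℝ) 1 := Ioo_subset_Ioo le_rfl hx.2
  have h2 := hu.deriv_sq_int.mono_set hsub
  have h1 : IntegrableOn u' (Ioo 0 x) := integrableOn_of_sq
    ((hc.mono (hsub.trans Ioo_subset_Ioc_self)).aestronglyMeasurable measurableSet_Ioo) h2
  have h3 := sq_setIntegral_Ioo_le hx.1 h1 h2
  rw [hu.ftc x hx, h0, zero_add]
  refine h3.trans (mul_le_mul_of_nonneg_left ?_ hx.1)
  exact setIntegral_mono_set hu.deriv_sq_int (Eventually.of_forall fun _ => sq_nonneg _)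
    hsub.eventuallyLE

lemma ClassicalSol.y_sq_le (hy : ClassicalSol a b β y yt yx ytt ytx yxx) {t x : ℝ}
    (ht : 0 ≤ t) (hx : x ∈ Icc (0 : ℝ) 1) :
    y t x ^ 2 ≤ x * ∫ s in Ioo (0 : ℝ) 1, yx t s ^ 2 :=
  (hy.regx t ht).toMemH1.sq_le (hy.regx t ht).zero (hy.yx_continuousOn ht) hx

lemma ClassicalSol.yt_sq_le (hy : ClassicalSol a b β y yt yx ytt ytx yxx) {t x : ℝ}
    (ht : 0 ≤ t) (hx : x ∈ Icc (0 : ℝ) 1) :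
    yt t x ^ 2 ≤ x * ∫ s in Ioo (0 : ℝ) 1, ytx t s ^ 2 :=
  (hy.regt t ht).toMemH1.sq_le (hy.regt t ht).zero (hy.cont_tx.uncurry_slice ht) hx

lemma ClassicalSol.energy_eq (hy : ClassicalSol a b β y yt yx ytt ytx yxx)
    (h : HypH1 a a' b K) {t : ℝ} (ht : 0 ≤ t) :
    2 * energy a b β y yt yx t = (∫ x in Ioo (0 : ℝ) 1, yt t x ^ 2 / sigW a b x)
      + (∫ x in Ioo (0 : ℝ) 1, etaW a b x * yx t x ^ 2) + β * y t 1 ^ 2 := by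
  rw [energy, integral_add (hy.integrableOn_yt ht) (hy.integrableOn_yx h ht)]
  ring

lemma HypH1.integral_yt_nonneg (h : HypH1 a a' b K) (f : ℝ → ℝ) :
    0 ≤ ∫ x in Ioo (0 : ℝ) 1, f x ^ 2 / sigW a b x :=
  setIntegral_nonneg measurableSet_Ioo fun _ hx =>
    div_nonneg (sq_nonneg _) (h.sigW_pos ⟨hx.1, hx.2.le⟩).le

lemma integral_eta_mul_nonneg (f : ℝ → ℝ) :
    0 ≤ ∫ x in Ioo (0 : ℝ) 1, etaW a b x * f x ^ 2 :=
  integral_nonneg fun x => mul_nonneg (etaW_pos a b x).le (sq_nonneg _)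

lemma ClassicalSol.integral_yx_sq_le (hy : ClassicalSol a b β y yt yx ytt ytx yxx)
    (h : HypH1 a a' b K) {t : ℝ} (ht : 0 ≤ t) :
    ∫ x in Ioo (0 : ℝ) 1, yx t x ^ 2
      ≤ (∫ x in Ioo (0 : ℝ) 1, etaW a b x * yx t x ^ 2) / sInf (etaW a b '' Icc 0 1) := by
  rw [le_div_iff₀ h.sInf_etaW.1, mul_comm, ← integral_const_mul]
  refine setIntegral_mono_on ((hy.regx t ht).deriv_sq_int.const_mul _)
    (hy.integrableOn_yx h ht) measurableSet_Ioo fun x hx => ?_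
  exact mul_le_mul_of_nonneg_right (h.sInf_etaW.2 x (Ioo_subset_Icc_self hx)) (sq_nonneg _)

lemma ClassicalSol.energy_nonneg (hy : ClassicalSol a b β y yt yx ytt ytx yxx)
    (h : HypH1 a a' b K) (hβ : 0 ≤ β) {t : ℝ} (ht : 0 ≤ t) : 0 ≤ energy a b β y yt yx t := by
  have h1 := hy.energy_eq h ht
  have h2 := h.integral_yt_nonneg (yt t)
  have h3 := integral_eta_mul_nonneg (a := a) (b := b) (yx t)
  have h4 := mul_nonneg hβ (sq_nonneg (y t 1))
  linarith

lemma ClassicalSol.y_sq_le_energy (hy : ClassicalSol a b β y yt yx ytt ytx yxx)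
    (h : HypH1 a a' b K) (hβ : 0 ≤ β) {t x : ℝ} (ht : 0 ≤ t) (hx : x ∈ Icc (0 : ℝ) 1) :
    y t x ^ 2 ≤ x * (2 * energy a b β y yt yx t / sInf (etaW a b '' Icc 0 1)) := by
  refine (hy.y_sq_le ht hx).trans (mul_le_mul_of_nonneg_left ?_ hx.1)
  refine (hy.integral_yx_sq_le h ht).trans (div_le_div_of_nonneg_right ?_ h.sInf_etaW.1.le)
  have h1 := hy.energy_eq h ht
  have h2 := h.integral_yt_nonneg (yt t)
  have h4 := mul_nonneg hβ (sq_nonneg (y t 1))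
  linarith

/-- `η y_x` is differentiable in space, with derivative `y_tt / σ`. -/
lemma ClassicalSol.flux_hasDerivAt (hy : ClassicalSol a b β y yt yx ytt ytx yxx)
    (h : HypH1 a a' b K) {t x : ℝ} (ht : 0 < t) (hx : x ∈ Ioo (0 : ℝ) 1) :
    HasDerivAt (fun x => etaW a b x * yx t x) (ytt t x / sigW a b x) x := by
  rw [hy.ytt_div_sigW h ht hx]
  exact (h.etaW_hasDerivAt hx).mul (hy.dxx t x ht.le ⟨hx.1, hx.2.le⟩)

lemma ClassicalSol.energy_hasDerivAt (hy : ClassicalSol a b β y yt yx ytt ytx yxx)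
    (h : HypH1 a a' b K) {t : ℝ} (ht : 0 < t) :
    HasDerivAt (energy a b β y yt yx) (-(yt t 1) ^ 2) t := by
  set f : ℝ → ℝ := fun x =>
    2 * yt t x * ytt t x / sigW a b x + 2 * etaW a b x * yx t x * ytx t x with hf
  set p : ℝ → ℝ := fun x => etaW a b x * yx t x with hp
  set S := sSup (etaW a b '' Icc 0 1)
  have cσ := h.sigW_continuousOn
  have cη := h.etaW_continuousOn
  have cyt := hy.yt_continuousOn ht.le
  have cyx := hy.yx_continuousOn ht.le
  have cytt : ContinuousOn (ytt t) (Ioc 0 1) := hy.cont_tt.uncurry_slice ht.le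
  have cytx : ContinuousOn (ytx t) (Ioc 0 1) := hy.cont_tx.uncurry_slice ht.le
  have hσ : ∀ x ∈ Ioc (0 : ℝ) 1, sigW a b x ≠ 0 := fun x hx => (h.sigW_pos hx).ne'
  have cf : ContinuousOn f (Ioc 0 1) := by
    have cσ' := cσ.mono Ioc_subset_Icc_self
    have cη' := cη.mono Ioc_subset_Icc_self
    exact (((continuousOn_const.mul cyt).mul cytt).div cσ' hσ).add
      (((continuousOn_const.mul cη').mul cyx).mul cytx)
  have fint : IntegrableOn f (Ioo 0 1) := by
    have hytx := h.integrableOn_eta_mul cytx (hy.regt t ht.le).deriv_sq_int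
    refine Integrable.mono' (((hy.integrableOn_yt ht.le).add (hy.integrableOn_ytt h ht)).add
      ((hy.integrableOn_yx h ht.le).add hytx))
      ((cf.mono Ioo_subset_Ioc_self).aestronglyMeasurable measurableSet_Ioo) ?_
    filter_upwards [ae_restrict_mem measurableSet_Ioo] with x hx
    have h1 := h.sigW_pos ⟨hx.1, hx.2.le⟩
    have h2 := etaW_pos a b x
    have e1 : 2 * yt t x * ytt t x / sigW a b x = (2 * yt t x * ytt t x) * (sigW a b x)⁻¹ := by
      rw [div_eq_mul_inv]
    have h3 := inv_pos.2 h1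
    simp only [hf, Real.norm_eq_abs, Pi.add_apply, div_eq_mul_inv]
    rw [abs_le]
    constructor <;>
    nlinarith [mul_nonneg h3.le (sq_nonneg (yt t x + ytt t x)),
      mul_nonneg h3.le (sq_nonneg (yt t x - ytt t x)),
      mul_nonneg h2.le (sq_nonneg (yx t x + ytx t x)),
      mul_nonneg h2.le (sq_nonneg (yx t x - ytx t x))]
  have ftc : ∀ x ∈ Ioo (0 : ℝ) 1, ∫ s in Ioo x 1, f s = 2 * (p 1 * yt t 1) - 2 * (p x * yt t x) := by
    intro x hx
    have hsub : Icc x 1 ⊆ Ioc (0 : ℝ) 1 := fun z hz => ⟨hx.1.trans_le hz.1, hz.2⟩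
    rw [setIntegral_Ioo_eq_intervalIntegral hx.2.le]
    refine intervalIntegral.integral_eq_sub_of_hasDerivAt_of_le
      (f := fun x => 2 * (p x * yt t x)) hx.2.le ?_ ?_ ?_
    · exact continuousOn_const.mul (((cη.mono Ioc_subset_Icc_self).mul cyx).mul cyt |>.mono hsub)
    · intro z hz
      have hz' : z ∈ Ioo (0 : ℝ) 1 := ⟨hx.1.trans hz.1, hz.2⟩
      refine (((hy.flux_hasDerivAt h ht hz').mul
        (hy.dtx t z ht.le ⟨hz'.1, hz'.2.le⟩)).const_mul 2).congr_deriv ?_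
      simp only [hf]
      ring
    · exact (cf.mono (by rwa [uIcc_of_le hx.2.le])).intervalIntegrable
  have hJ : ∫ x in Ioo (0 : ℝ) 1, f x = 2 * (p 1 * yt t 1) := by
    by_contra hne
    set D := (∫ x in Ioo (0 : ℝ) 1, f x) - 2 * (p 1 * yt t 1) with hD
    have hD0 : 0 < |D| := abs_pos.2 (sub_ne_zero.2 hne)
    set C := ∫ s in Ioo (0 : ℝ) 1, ytx t s ^ 2
    have hC : 0 ≤ C := integral_nonneg fun _ => sq_nonneg _
    have hden : 0 < S ^ 2 * C + 1 := by positivity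
    have hτ : 0 < (|D| / 4) ^ 2 / (S ^ 2 * C + 1) := by positivity
    have fr := frequently_mul_lt (hy.regx t ht.le).deriv_sq_int (P := fun _ => True)
      (Eventually.of_forall fun _ => trivial) hτ
    have ev : ∀ᶠ x in 𝓝[>] (0 : ℝ), |∫ s in Ioo 0 x, f s| < |D| / 2 := by
      have := (tendsto_setIntegral_Ioo_zero fint).abs
      rw [abs_zero] at this
      exact this.eventually_lt_const (by positivity)
    obtain ⟨x, ⟨⟨-, hx1⟩, hx2⟩, hx⟩ := ((fr.and_eventually ev).and_eventually
      (Ioo_mem_nhdsGT (zero_lt_one (α := ℝ)))).exists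
    have e1 := setIntegral_Ioo_add hx fint
    rw [ftc x hx] at e1
    have e2 : D = (∫ s in Ioo 0 x, f s) - 2 * (p x * yt t x) := by rw [hD]; linarith
    have e3 : |D| ≤ |∫ s in Ioo 0 x, f s| + 2 * |p x * yt t x| := by
      rw [e2]
      refine (abs_sub _ _).trans ?_
      rw [abs_mul 2, abs_two]
    have e4 : |D| / 4 < |p x * yt t x| := by linarith
    have e5 : (|D| / 4) ^ 2 < (p x * yt t x) ^ 2 := by
      rw [← sq_abs (p x * yt t x)]
      exact pow_lt_pow_left₀ e4 (by positivity) two_ne_zero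
    have e6 := hy.yt_sq_le ht.le (Ioo_subset_Icc_self hx)
    have e7 : etaW a b x ^ 2 ≤ S ^ 2 :=
      pow_le_pow_left₀ (etaW_pos a b x).le (h.le_sSup_etaW (Ioo_subset_Icc_self hx)) 2
    have e8 : (p x * yt t x) ^ 2 ≤ (S ^ 2 * C) * (x * yx t x ^ 2) := by
      calc (p x * yt t x) ^ 2 = etaW a b x ^ 2 * yx t x ^ 2 * yt t x ^ 2 := by
            simp only [hp]; ring
        _ ≤ S ^ 2 * yx t x ^ 2 * (x * C) := by gcongr
        _ = _ := by ring
    rw [lt_div_iff₀ hden] at hx1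
    nlinarith [mul_nonneg hx.1.le (sq_nonneg (yx t x))]
  have hd := ((hy.ediff t ht.le).add (((hy.dt t 1 ht.le (by simp)).pow 2).const_mul β)).const_mul
    (1 / 2)
  refine hd.congr_deriv ?_
  have hb := hy.bc1 t ht
  have hJ' : (∫ x in Ioo (0 : ℝ) 1,
      (2 * yt t x * ytt t x / sigW a b x + 2 * etaW a b x * yx t x * ytx t x))
      = 2 * (p 1 * yt t 1) := hJ
  rw [hJ']
  simp only [hp]
  have : etaW a b 1 * yx t 1 = -yt t 1 - β * y t 1 := by linarith
  rw [this]
  push_cast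
  ring

lemma ClassicalSol.energy_continuousOn (hy : ClassicalSol a b β y yt yx ytt ytx yxx) :
    ContinuousOn (energy a b β y yt yx) (Ici 0) := fun t ht =>
  (((hy.ediff t ht).continuousAt.add (((hy.dt t 1 ht (by simp)).continuousAt.pow 2).const_mul
    β)).const_mul (1 / 2)).continuousWithinAt

lemma ClassicalSol.energy_antitoneOn (hy : ClassicalSol a b β y yt yx ytt ytx yxx)
    (h : HypH1 a a' b K) : AntitoneOn (energy a b β y yt yx) (Ici 0) := by
  refine antitoneOn_of_deriv_nonpos (convex_Ici 0) hy.energy_continuousOn ?_ ?_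
  · rw [interior_Ici]
    exact fun t ht => (hy.energy_hasDerivAt h ht).differentiableAt.differentiableWithinAt
  · rw [interior_Ici]
    intro t ht
    rw [(hy.energy_hasDerivAt h ht).deriv]
    exact neg_nonpos.2 (sq_nonneg _)

end Solution

/-! ### The multiplier functional -/

/-- The density of the functional built from the multipliers `x y_x`, `y` and the profile `Z`. -/
noncomputable def multiplier (a b : ℝ → ℝ) (K γ : ℝ) (y yt yx : ℝ → ℝ → ℝ) (t x : ℝ) : ℝ :=
  (x * (yx t x * yt t x) - K / 4 * (y t x * yt t x)
    + γ * (y t 1 * (profile a b x * yt t x))) / sigW a b x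

/-- The time derivative of `multiplier`. -/
noncomputable def multiplierDeriv (a b : ℝ → ℝ) (K γ : ℝ) (y yt yx ytt ytx : ℝ → ℝ → ℝ)
    (t x : ℝ) : ℝ :=
  (x * (ytx t x * yt t x + yx t x * ytt t x) - K / 4 * (yt t x * yt t x + y t x * ytt t x)
    + γ * (yt t 1 * (profile a b x * yt t x) + y t 1 * (profile a b x * ytt t x)))
    / sigW a b x

lemma Asymptotics.IsBigO.mul_of_one {α : Type*} {l : Filter α} {f g : α → ℝ}
    (hf : f =O[l] fun _ => (1 : ℝ)) (hg : g =O[l] fun _ => (1 : ℝ)) :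
    (fun x => f x * g x) =O[l] fun _ => (1 : ℝ) := by
  simpa using hf.mul hg

lemma isBigO_one_of_continuousOn {α : Type*} [TopologicalSpace α] {f : α → ℝ} {S S' : Set α}
    (hS : IsCompact S') (hf : ContinuousOn f S') (h : S ⊆ S') :
    f =O[𝓟 S] fun _ => (1 : ℝ) := by
  obtain ⟨C, hC⟩ := hS.exists_bound_of_continuousOn hf
  exact Asymptotics.isBigO_principal.2 ⟨C, fun x hx => by simpa using hC x (h hx)⟩

lemma isBigO_one_of_hasDerivAt {f ft : ℝ → ℝ → ℝ} {s T : ℝ} {A A' : Set ℝ}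
    (hft : Function.uncurry ft =O[𝓟 (Icc s T ×ˢ A)] fun _ => (1 : ℝ))
    (hd : ∀ t ∈ Icc s T, ∀ x ∈ A, HasDerivAt (fun r => f r x) (ft t x) t)
    (hA : IsCompact A') (hc : ContinuousOn (f s) A') (hAA : A ⊆ A') :
    Function.uncurry f =O[𝓟 (Icc s T ×ˢ A)] fun _ => (1 : ℝ) := by
  obtain ⟨C, hC⟩ := Asymptotics.isBigO_principal.1 hft
  obtain ⟨C', hC'⟩ := hA.exists_bound_of_continuousOn hc
  refine Asymptotics.isBigO_principal.2 ⟨C' + C * (T - s), ?_⟩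
  rintro ⟨t, x⟩ ⟨ht, hx⟩
  have hst : s ≤ T := ht.1.trans ht.2
  have hC0 : 0 ≤ C := by
    have := hC (t, x) ⟨ht, hx⟩
    simp only [norm_one, mul_one] at this
    exact (norm_nonneg _).trans this
  have h1 := (convex_Icc s T).norm_image_sub_le_of_norm_hasDerivWithin_le
    (f := fun r => f r x) (f' := fun r => ft r x) (C := C)
    (fun r hr => (hd r hr x hx).hasDerivWithinAt)
    (fun r hr => by simpa using hC (r, x) ⟨hr, hx⟩) (left_mem_Icc.2 hst) ht
  have h2 := hC' x (hAA hx)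
  have h3 : ‖t - s‖ ≤ T - s := by
    rw [Real.norm_eq_abs, abs_of_nonneg (sub_nonneg.2 ht.1)]
    linarith [ht.2]
  have h4 := mul_le_mul_of_nonneg_left h3 hC0
  have h5 : ‖f t x‖ ≤ ‖f s x‖ + ‖f t x - f s x‖ := by
    have := norm_add_le (f s x) (f t x - f s x)
    rwa [add_sub_cancel] at this
  simp only [Function.uncurry, norm_one, mul_one]
  linarith

section Solution

variable {a a' b : ℝ → ℝ} {K β : ℝ} {y yt yx ytt ytx yxx : ℝ → ℝ → ℝ}

lemma ClassicalSol.yx_hasDerivAt_time (hy : ClassicalSol a b β y yt yx ytt ytx yxx) {t x : ℝ}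
    (ht : 0 < t) (hx : x ∈ Ioo (0 : ℝ) 1) : HasDerivAt (fun r => yx r x) (ytx t x) t := by
  have hs : 0 < t / 2 := by positivity
  have hytc : ∀ ξ ∈ Icc (0 : ℝ) 1, ContinuousOn (fun r => yt r ξ) (Ici 0) := fun ξ hξ r hr =>
    (hy.dtt r ξ hr hξ).continuousAt.continuousWithinAt
  have hytxc : ContinuousOn (fun r => ytx r x) (Ici 0) :=
    hy.cont_tx.comp (f := fun r => (r, x)) (by fun_prop) fun _ hr => ⟨hr, hx.1, hx.2.le⟩
  have key : ∀ r ∈ Ioi (t / 2), yx r x = yx (t / 2) x + ∫ τ in (t / 2)..r, ytx τ x := by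
    intro r hr
    have hr' : t / 2 ≤ r := le_of_lt hr
    have hIcc : uIcc (t / 2) r ⊆ Ici 0 := by
      rw [uIcc_of_le hr']
      exact fun z hz => hs.le.trans hz.1
    have hIoc : uIoc (t / 2) r ⊆ Icc (t / 2) r := by
      rw [uIoc_of_le hr']; exact Ioc_subset_Icc_self
    have hrep : ∀ ξ ∈ Icc (0 : ℝ) 1, ∫ τ in (t / 2)..r, yt τ ξ = y r ξ - y (t / 2) ξ :=
      fun ξ hξ => intervalIntegral.integral_eq_sub_of_hasDerivAt
        (fun z hz => hy.dt z ξ (hIcc hz) hξ) ((hytc ξ hξ).mono hIcc).intervalIntegrable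
    set U := Icc (x / 2) ((x + 1) / 2) with hU
    have hU' : U ⊆ Ioo 0 1 := fun z hz => ⟨by linarith [hz.1, hx.1], by linarith [hz.2, hx.2]⟩
    have hxU : U ∈ 𝓝 x := Icc_mem_nhds (by linarith [hx.1]) (by linarith [hx.2])
    obtain ⟨C, hC⟩ := (isCompact_Icc.prod isCompact_Icc :
      IsCompact (Icc (t / 2) r ×ˢ U)).exists_bound_of_continuousOn (hy.cont_tx.mono
        (prod_mono (fun z hz => hs.le.trans hz.1) (hU'.trans Ioo_subset_Ioc_self)))
    have hd := (intervalIntegral.hasDerivAt_integral_of_dominated_loc_of_deriv_le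
      (μ := volume) (F := fun ξ τ => yt τ ξ) (F' := fun ξ τ => ytx τ ξ) (a := t / 2) (b := r)
      (bound := fun _ => C) hxU ?_ ?_ ?_ ?_ (by simp) ?_).2
    · have hd' : HasDerivAt (fun ξ => ∫ τ in (t / 2)..r, yt τ ξ)
          (yx r x - yx (t / 2) x) x := by
        refine ((hy.dx r x (hs.le.trans hr') ⟨hx.1, hx.2.le⟩).sub
          (hy.dx (t / 2) x hs.le ⟨hx.1, hx.2.le⟩)).congr_of_eventuallyEq ?_
        filter_upwards [Icc_mem_nhds hx.1 hx.2] with ξ hξ using hrep ξ hξ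
      have := hd.unique hd'
      linarith
    · filter_upwards [Icc_mem_nhds hx.1 hx.2] with ξ hξ
      exact ((hytc ξ hξ).mono (hIoc.trans fun z hz => hs.le.trans hz.1)).aestronglyMeasurable
        measurableSet_uIoc
    · exact ((hytc x (Ioo_subset_Icc_self hx)).mono hIcc).intervalIntegrable
    · exact (hytxc.mono (hIoc.trans fun z hz => hs.le.trans hz.1)).aestronglyMeasurable
        measurableSet_uIoc
    · exact Eventually.of_forall fun τ hτ ξ hξ => hC (τ, ξ) ⟨hIoc hτ, hξ⟩
    · exact Eventually.of_forall fun τ hτ ξ hξ =>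
        hy.dtx τ ξ (hs.le.trans (hIoc hτ).1) (Ioo_subset_Ioc_self (hU' hξ))
  have hd : HasDerivAt (fun r => yx (t / 2) x + ∫ τ in (t / 2)..r, ytx τ x) (ytx t x) t := by
    refine (intervalIntegral.integral_hasDerivAt_right ?_
      ((hytxc.mono Ioi_subset_Ici_self).stronglyMeasurableAtFilter isOpen_Ioi t ht)
      ((hytxc t ht.le).continuousAt (Ici_mem_nhds ht))).const_add _
    refine ContinuousOn.intervalIntegrable (hytxc.mono ?_)
    rw [uIcc_of_le (by linarith)]
    exact fun z hz => hs.le.trans hz.1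
  refine hd.congr_of_eventuallyEq ?_
  filter_upwards [Ioi_mem_nhds (show t / 2 < t by linarith)] with r hr using key r hr

lemma ClassicalSol.multiplier_continuousOn (hy : ClassicalSol a b β y yt yx ytt ytx yxx)
    (h : HypH1 a a' b K) (γ : ℝ) {t : ℝ} (ht : 0 ≤ t) :
    ContinuousOn (multiplier a b K γ y yt yx t) (Ioc 0 1) := by
  have cσ := h.sigW_continuousOn.mono Ioc_subset_Icc_self
  have cZ := h.profile_continuousOn.mono Ioc_subset_Icc_self
  have cyt := hy.yt_continuousOn ht
  have cyx := hy.yx_continuousOn ht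
  have cy := hy.y_continuousOn ht
  unfold multiplier
  exact ContinuousOn.div (by fun_prop) cσ fun x hx => (h.sigW_pos hx).ne'

lemma ClassicalSol.multiplierDeriv_continuousOn (hy : ClassicalSol a b β y yt yx ytt ytx yxx)
    (h : HypH1 a a' b K) (γ : ℝ) {t : ℝ} (ht : 0 ≤ t) :
    ContinuousOn (multiplierDeriv a b K γ y yt yx ytt ytx t) (Ioc 0 1) := by
  have cσ := h.sigW_continuousOn.mono Ioc_subset_Icc_self
  have cZ := h.profile_continuousOn.mono Ioc_subset_Icc_self
  have cyt := hy.yt_continuousOn ht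
  have cyx := hy.yx_continuousOn ht
  have cy := hy.y_continuousOn ht
  have cytt : ContinuousOn (ytt t) (Ioc 0 1) := hy.cont_tt.uncurry_slice ht
  have cytx : ContinuousOn (ytx t) (Ioc 0 1) := hy.cont_tx.uncurry_slice ht
  unfold multiplierDeriv
  exact ContinuousOn.div (by fun_prop) cσ fun x hx => (h.sigW_pos hx).ne'

lemma ClassicalSol.integral_multiplier_hasDerivAt
    (hy : ClassicalSol a b β y yt yx ytt ytx yxx) (h : HypH1 a a' b K) (γ : ℝ) {t ε : ℝ}
    (ht : 0 < t) (hε : ε ∈ Ioo (0 : ℝ) 1) :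
    HasDerivAt (fun r => ∫ x in Ioo ε 1, multiplier a b K γ y yt yx r x)
      (∫ x in Ioo ε 1, multiplierDeriv a b K γ y yt yx ytt ytx t x) t := by
  have hsub : Icc ε 1 ⊆ Ioc (0 : ℝ) 1 := fun z hz => ⟨hε.1.trans_le hz.1, hz.2⟩
  have hsub' : Ioo ε 1 ⊆ Ioc (0 : ℝ) 1 := Ioo_subset_Icc_self.trans hsub
  set S : Set (ℝ × ℝ) := Icc (t / 2) (2 * t) ×ˢ Ioo ε 1 with hS
  have hs : 0 < t / 2 := by positivity
  have ht0 : ∀ r ∈ Icc (t / 2) (2 * t), 0 ≤ r := fun r hr => hs.le.trans hr.1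
  have hprod : Icc (t / 2) (2 * t) ×ˢ Icc ε 1 ⊆ Ici 0 ×ˢ Ioc (0 : ℝ) 1 :=
    prod_mono (fun r hr => ht0 r hr) hsub
  have hcpt : IsCompact (Icc (t / 2) (2 * t) ×ˢ Icc ε 1) := isCompact_Icc.prod isCompact_Icc
  have hSs : S ⊆ Icc (t / 2) (2 * t) ×ˢ Icc ε 1 := prod_mono le_rfl Ioo_subset_Icc_self
  have btt : Function.uncurry ytt =O[𝓟 S] fun _ => (1 : ℝ) :=
    isBigO_one_of_continuousOn hcpt (hy.cont_tt.mono hprod) hSs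
  have btx : Function.uncurry ytx =O[𝓟 S] fun _ => (1 : ℝ) :=
    isBigO_one_of_continuousOn hcpt (hy.cont_tx.mono hprod) hSs
  have bt : Function.uncurry yt =O[𝓟 S] fun _ => (1 : ℝ) :=
    isBigO_one_of_hasDerivAt btt
      (fun r hr x hx => hy.dtt r x (ht0 r hr) (Ioc_subset_Icc_self (hsub' hx)))
      isCompact_Icc ((hy.yt_continuousOn hs.le).mono hsub) Ioo_subset_Icc_self
  have bx : Function.uncurry yx =O[𝓟 S] fun _ => (1 : ℝ) :=
    isBigO_one_of_hasDerivAt btx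
      (fun r hr x hx => hy.yx_hasDerivAt_time (hs.trans_le hr.1) ⟨hε.1.trans hx.1, hx.2⟩)
      isCompact_Icc ((hy.yx_continuousOn hs.le).mono hsub) Ioo_subset_Icc_self
  have b0 : Function.uncurry y =O[𝓟 S] fun _ => (1 : ℝ) :=
    isBigO_one_of_hasDerivAt bt
      (fun r hr x hx => hy.dt r x (ht0 r hr) (Ioc_subset_Icc_self (hsub' hx)))
      isCompact_Icc ((hy.y_continuousOn hs.le).mono hsub) Ioo_subset_Icc_self
  have cspace : ∀ f : ℝ → ℝ, ContinuousOn f (Ioc 0 1) →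
      (fun q : ℝ × ℝ => f q.2) =O[𝓟 S] fun _ => (1 : ℝ) := fun f hf =>
    isBigO_one_of_continuousOn hcpt
      ((hf.mono hsub).comp continuousOn_snd fun q hq => hq.2) hSs
  have ctime : ∀ f : ℝ → ℝ, ContinuousOn f (Ici 0) →
      (fun q : ℝ × ℝ => f q.1) =O[𝓟 S] fun _ => (1 : ℝ) := fun f hf =>
    isBigO_one_of_continuousOn hcpt
      (hf.comp continuousOn_fst fun q hq => ht0 _ hq.1) hSs
  have bZ := cspace (profile a b) (h.profile_continuousOn.mono Ioc_subset_Icc_self)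
  have bσ := cspace (fun x => (sigW a b x)⁻¹) ((h.sigW_continuousOn.mono
    Ioc_subset_Icc_self).inv₀ fun x hx => (h.sigW_pos hx).ne')
  have bid := cspace (fun x => x) continuousOn_id
  have by1 := ctime (fun r => y r 1) fun r hr =>
    (hy.dt r 1 hr (by simp)).continuousAt.continuousWithinAt
  have byt1 := ctime (fun r => yt r 1) fun r hr =>
    (hy.dtt r 1 hr (by simp)).continuousAt.continuousWithinAt
  have bc : ∀ c : ℝ, (fun _ : ℝ × ℝ => c) =O[𝓟 S] fun _ => (1 : ℝ) := fun c =>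
    cspace (fun _ => c) continuousOn_const
  have bW : (fun q : ℝ × ℝ => multiplierDeriv a b K γ y yt yx ytt ytx q.1 q.2)
      =O[𝓟 S] fun _ => (1 : ℝ) := by
    unfold multiplierDeriv
    simp only [div_eq_mul_inv _ (sigW _ _ _)]
    exact (((bid.mul_of_one ((btx.mul_of_one bt).add (bx.mul_of_one btt))).sub
      ((bc (K / 4)).mul_of_one ((bt.mul_of_one bt).add (b0.mul_of_one btt)))).add
      ((bc γ).mul_of_one ((byt1.mul_of_one (bZ.mul_of_one bt)).add
        (by1.mul_of_one (bZ.mul_of_one btt))))).mul_of_one bσ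
  obtain ⟨C, hC⟩ := Asymptotics.isBigO_principal.1 bW
  refine (hasDerivAt_integral_of_dominated_loc_of_deriv_le (μ := volume.restrict (Ioo ε 1))
    (F := multiplier a b K γ y yt yx) (F' := multiplierDeriv a b K γ y yt yx ytt ytx)
    (bound := fun _ => C) (Icc_mem_nhds (show t / 2 < t by linarith)
      (show t < 2 * t by linarith))
    ?_ ?_ ?_ ?_ (by simp) ?_).2
  · filter_upwards [Ioi_mem_nhds ht] with r hr
    exact ((hy.multiplier_continuousOn h γ (le_of_lt hr)).mono hsub').aestronglyMeasurable
      measurableSet_Ioo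
  · exact (((hy.multiplier_continuousOn h γ ht.le).mono hsub).integrableOn_Icc).mono_set
      Ioo_subset_Icc_self
  · exact ((hy.multiplierDeriv_continuousOn h γ ht.le).mono hsub').aestronglyMeasurable
      measurableSet_Ioo
  · filter_upwards [ae_restrict_mem measurableSet_Ioo] with x hx r hr
    simpa using hC (r, x) ⟨hr, hx⟩
  · filter_upwards [ae_restrict_mem measurableSet_Ioo] with x hx r hr
    have hr0 : 0 < r := hs.trans_le hr.1
    have hx1 : x ∈ Icc (0 : ℝ) 1 := Ioc_subset_Icc_self (hsub' hx)
    have d0 := hy.dt r x hr0.le hx1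
    have d1 := hy.dt r 1 hr0.le (by simp)
    have dt := hy.dtt r x hr0.le hx1
    have dx := hy.yx_hasDerivAt_time hr0 ⟨hε.1.trans hx.1, hx.2⟩
    refine (((((dx.mul dt).const_mul x).sub ((d0.mul dt).const_mul (K / 4))).add
      ((d1.mul (dt.const_mul (profile a b x))).const_mul γ)).div_const
      (sigW a b x)).congr_deriv ?_
    simp only [multiplierDeriv]

end Solution

/-- The spatial flux associated with `multiplier`. -/
noncomputable def flux (a b : ℝ → ℝ) (K γ : ℝ) (y yt yx : ℝ → ℝ → ℝ) (t x : ℝ) : ℝ :=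
  1 / 2 * (x * yt t x ^ 2 / sigW a b x) + 1 / 2 * (x * (etaW a b x * yx t x) ^ 2 / etaW a b x)
    - K / 4 * (y t x * (etaW a b x * yx t x))
    + γ * y t 1 * (profile a b x * (etaW a b x * yx t x) - y t x)

section Solution

variable {a a' b : ℝ → ℝ} {K β ε₀ : ℝ} {y yt yx ytt ytx yxx : ℝ → ℝ → ℝ}

lemma ClassicalSol.flux_continuousOn (hy : ClassicalSol a b β y yt yx ytt ytx yxx)
    (h : HypH1 a a' b K) (γ : ℝ) {t : ℝ} (ht : 0 ≤ t) :
    ContinuousOn (flux a b K γ y yt yx t) (Ioc 0 1) := by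
  have cσ := h.sigW_continuousOn.mono Ioc_subset_Icc_self
  have cη := h.etaW_continuousOn.mono Ioc_subset_Icc_self
  have cZ := h.profile_continuousOn.mono Ioc_subset_Icc_self
  have cyt := hy.yt_continuousOn ht
  have cyx := hy.yx_continuousOn ht
  have cy := hy.y_continuousOn ht
  have c1 : ContinuousOn (fun x => x * yt t x ^ 2 / sigW a b x) (Ioc 0 1) :=
    ContinuousOn.div (by fun_prop) cσ fun x hx => (h.sigW_pos hx).ne'
  have c2 : ContinuousOn (fun x => x * (etaW a b x * yx t x) ^ 2 / etaW a b x) (Ioc 0 1) :=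
    ContinuousOn.div (by fun_prop) cη fun x _ => (etaW_pos a b x).ne'
  unfold flux
  fun_prop

lemma ClassicalSol.flux_hasDerivAt_space (hy : ClassicalSol a b β y yt yx ytt ytx yxx)
    (h : HypH1 a a' b K) (γ : ℝ) {t x : ℝ} (ht : 0 < t) (hx : x ∈ Ioo (0 : ℝ) 1) :
    HasDerivAt (flux a b K γ y yt yx t)
      (multiplierDeriv a b K γ y yt yx ytt ytx t x
        - γ * (yt t 1 * (profile a b x * yt t x)) / sigW a b x
        + 1 / 2 * (1 + K / 2 - x * (a' x - b x) / a x) * (yt t x ^ 2 / sigW a b x)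
        + 1 / 2 * (1 - K / 2 - x * b x / a x) * (etaW a b x * yx t x ^ 2)) x := by
  have hx' : x ∈ Ioc (0 : ℝ) 1 := ⟨hx.1, hx.2.le⟩
  have hσ := (h.sigW_pos hx').ne'
  have hη := (etaW_pos a b x).ne'
  have ha := (h.pos x hx').ne'
  have dp := hy.flux_hasDerivAt h ht hx
  have dyt := hy.dtx t x ht.le hx'
  have dy := hy.dx t x ht.le hx'
  have d1 := ((hasDerivAt_id x).mul (dyt.pow 2)).div (h.sigW_hasDerivAt hx) hσ
  have d2 := ((hasDerivAt_id x).mul (dp.pow 2)).div (h.etaW_hasDerivAt hx) hη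
  have d3 := dy.mul dp
  have d4 := ((h.profile_hasDerivAt hx).mul dp).sub dy
  refine ((((d1.const_mul (1 / 2)).add (d2.const_mul (1 / 2))).sub
    (d3.const_mul (K / 4))).add (d4.const_mul (γ * y t 1))).congr_deriv ?_
  simp only [multiplierDeriv, sigW, id, Pi.mul_apply, Pi.pow_apply]
  push_cast
  field_simp
  ring

lemma ClassicalSol.integral_multiplierDeriv_le (hy : ClassicalSol a b β y yt yx ytt ytx yxx)
    (h : HypH2 a a' b K ε₀) (γ : ℝ) {t ε : ℝ} (ht : 0 < t) (hε : ε ∈ Ioo (0 : ℝ) 1) :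
    ∫ x in Ioo ε 1, (multiplierDeriv a b K γ y yt yx ytt ytx t x
        + ε₀ / 4 * (yt t x ^ 2 / sigW a b x + etaW a b x * yx t x ^ 2)
        - γ * (yt t 1 * (profile a b x * yt t x)) / sigW a b x)
      ≤ flux a b K γ y yt yx t 1 - flux a b K γ y yt yx t ε := by
  have h1 := h.1
  have hsub : Icc ε 1 ⊆ Ioc (0 : ℝ) 1 := fun z hz => ⟨hε.1.trans_le hz.1, hz.2⟩
  rw [setIntegral_Ioo_eq_intervalIntegral hε.2.le]
  refine intervalIntegral.integral_le_sub_of_hasDeriv_right_of_le hε.2.le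
    ((hy.flux_continuousOn h1 γ ht.le).mono hsub)
    (fun x hx => (hy.flux_hasDerivAt_space h1 γ ht ⟨hε.1.trans hx.1, hx.2⟩).hasDerivWithinAt)
    ?_ ?_
  · refine ContinuousOn.integrableOn_Icc (ContinuousOn.mono ?_ hsub)
    have cσ := h1.sigW_continuousOn.mono Ioc_subset_Icc_self
    have cη := h1.etaW_continuousOn.mono Ioc_subset_Icc_self
    have cZ := h1.profile_continuousOn.mono Ioc_subset_Icc_self
    have cyt := hy.yt_continuousOn ht.le
    have cyx := hy.yx_continuousOn ht.le
    have cm := hy.multiplierDeriv_continuousOn h1 γ ht.le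
    have hσ : ∀ x ∈ Ioc (0 : ℝ) 1, sigW a b x ≠ 0 := fun x hx => (h1.sigW_pos hx).ne'
    have c1 : ContinuousOn (fun x => yt t x ^ 2 / sigW a b x) (Ioc 0 1) := (cyt.pow 2).div cσ hσ
    have c2 : ContinuousOn (fun x => γ * (yt t 1 * (profile a b x * yt t x)) / sigW a b x)
        (Ioc 0 1) := ContinuousOn.div (by fun_prop) cσ hσ
    fun_prop
  · intro x hx
    have hx' : x ∈ Ioc (0 : ℝ) 1 := ⟨hε.1.trans hx.1, hx.2.le⟩
    have ha := h1.pos x hx'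
    have k1 := h1.mul_abs_deriv_le hx'
    have k2 := h.2.2 x (Ioc_subset_Icc_self hx')
    have k3 := mul_le_mul_of_nonneg_left (le_abs_self (a' x)) hx'.1.le
    have k4 := mul_le_mul_of_nonneg_left (le_abs_self (b x)) hx'.1.le
    have k5 := mul_le_mul_of_nonneg_left (neg_abs_le (b x)) hx'.1.le
    have c1 : ε₀ / 2 ≤ 1 + K / 2 - x * (a' x - b x) / a x := by
      have : x * (a' x - b x) / a x ≤ 1 + K / 2 - ε₀ / 2 := by
        rw [div_le_iff₀ ha]; linarith
      linarith
    have c2 : ε₀ / 2 ≤ 1 - K / 2 - x * b x / a x := by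
      have : x * b x / a x ≤ 1 - K / 2 - ε₀ / 2 := by
        rw [div_le_iff₀ ha]; linarith
      linarith
    have q1 : 0 ≤ yt t x ^ 2 / sigW a b x := div_nonneg (sq_nonneg _) (h1.sigW_pos hx').le
    have q2 : 0 ≤ etaW a b x * yx t x ^ 2 := mul_nonneg (etaW_pos a b x).le (sq_nonneg _)
    linarith [mul_le_mul_of_nonneg_right c1 q1, mul_le_mul_of_nonneg_right c2 q2]

end Solution

section Dissipation

variable {a a' b : ℝ → ℝ} {K β ε₀ B C δ : ℝ} {y yt yx ytt ytx yxx : ℝ → ℝ → ℝ}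

lemma abs_mul_le_young {u v r : ℝ} (hr : 0 < r) : |u * v| ≤ r / 2 * v ^ 2 + u ^ 2 / (2 * r) := by
  have h1 : r / 2 * v ^ 2 + u ^ 2 / (2 * r) - |u * v| = (r * |v| - |u|) ^ 2 / (2 * r) := by
    rw [abs_mul]
    field_simp
    rw [sub_sq, mul_pow, sq_abs, sq_abs]
    ring
  have h2 : 0 ≤ (r * |v| - |u|) ^ 2 / (2 * r) := by positivity
  linarith

lemma boundary_flux_le {Y V η₁ : ℝ} (hη : 0 < η₁) (hβ : 0 ≤ β) (hK : 0 ≤ K) :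
    (V + β * Y) ^ 2 / η₁ + K / 2 * (Y * (V + β * Y))
      ≤ (1 / η₁ + β / η₁ + K / 4) * V ^ 2
        + (β ^ 2 / η₁ + K * β / 2 + β / η₁ + K / 4) * Y ^ 2 := by
  have h1 : (1 / η₁ + β / η₁ + K / 4) * V ^ 2
        + (β ^ 2 / η₁ + K * β / 2 + β / η₁ + K / 4) * Y ^ 2
        - ((V + β * Y) ^ 2 / η₁ + K / 2 * (Y * (V + β * Y)))
      = (β / η₁ + K / 4) * (V - Y) ^ 2 := by
    field_simp
    ring
  have h2 : 0 ≤ (β / η₁ + K / 4) * (V - Y) ^ 2 := by positivity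
  linarith

lemma ClassicalSol.integral_multiplierDeriv_sub_le
    (hy : ClassicalSol a b β y yt yx ytt ytx yxx) (h : HypH2 a a' b K ε₀) (hβ : 0 ≤ β)
    (hC : 0 ≤ C)
    (hHP : ∀ v v' : ℝ → ℝ, MemH1sig0 a b v v' →
      ∫ x in Ioo (0 : ℝ) 1, v x ^ 2 / sigW a b x ≤ C * ∫ x in Ioo (0 : ℝ) 1, v' x ^ 2)
    (hB : B = β ^ 2 / etaW a b 1 + K * β / 2 + β / etaW a b 1 + K / 4 + β * ε₀ / 2)
    (hδ : 0 < δ) {t ε : ℝ} (ht : 0 < t) (hε : ε ∈ Ioo (0 : ℝ) 1) :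
    2 * (∫ x in Ioo ε 1,
        multiplierDeriv a b K (B / 2 / (1 + β * profile a b 1)) y yt yx ytt ytx t x)
      ≤ (1 / sigW a b 1 + 1 / etaW a b 1 + β / etaW a b 1 + K / 4 + B / (2 * δ)
          + B * C / (2 * δ * sInf (etaW a b '' Icc 0 1) ^ 2)) * yt t 1 ^ 2
        - (ε₀ - δ * (B * (1 / sInf (etaW a b '' Icc 0 1) ^ 3 + 1))) * energy a b β y yt yx t
        + ε₀ / 2 * (∫ x in Ioo 0 ε, (yt t x ^ 2 / sigW a b x + etaW a b x * yx t x ^ 2))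
        - 2 * flux a b K (B / 2 / (1 + β * profile a b 1)) y yt yx t ε := by
  have h1 := h.1
  have hε₀ := h.2.1
  have hK := h1.K_mem.1
  have hη1 := etaW_pos a b 1
  have hm := h1.sInf_etaW.1
  set m := sInf (etaW a b '' Icc 0 1) with hm'
  have hB0 : 0 ≤ B := by rw [hB]; positivity
  obtain ⟨hN0, hN1⟩ := h1.profile_mem (x := 1) (by simp)
  set N := profile a b 1 with hN
  have hβN : 0 < 1 + β * N := by positivity
  set c := 1 / (1 + β * N) with hc
  have hc0 : 0 < c := by positivity
  have hc1 : c ≤ 1 := by rw [hc, div_le_one hβN]; linarith [mul_nonneg hβ hN0]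
  have hγ : B / 2 / (1 + β * N) = B / 2 * c := by rw [hc]; ring
  rw [hγ]
  set γ := B / 2 * c with hγ'
  have hsub : Icc ε 1 ⊆ Ioc (0 : ℝ) 1 := fun z hz => ⟨hε.1.trans_le hz.1, hz.2⟩
  have hint : ∀ f : ℝ → ℝ, ContinuousOn f (Ioc 0 1) → IntegrableOn f (Ioo ε 1) := fun f hf =>
    ((hf.mono hsub).integrableOn_Icc).mono_set Ioo_subset_Icc_self
  have cσ := h1.sigW_continuousOn.mono Ioc_subset_Icc_self
  have cη := h1.etaW_continuousOn.mono Ioc_subset_Icc_self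
  have cZ := h1.profile_continuousOn.mono Ioc_subset_Icc_self
  have cyt := hy.yt_continuousOn ht.le
  have cyx := hy.yx_continuousOn ht.le
  have cm := hy.multiplierDeriv_continuousOn h1 γ ht.le
  have hσ : ∀ x ∈ Ioc (0 : ℝ) 1, sigW a b x ≠ 0 := fun x hx => (h1.sigW_pos hx).ne'
  have c1 : ContinuousOn (fun x => yt t x ^ 2 / sigW a b x) (Ioc 0 1) := (cyt.pow 2).div cσ hσ
  have c2 : ContinuousOn (fun x => γ * (yt t 1 * (profile a b x * yt t x)) / sigW a b x)
      (Ioc 0 1) := ContinuousOn.div (by fun_prop) cσ hσ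
  have c3 : ContinuousOn (fun x => ε₀ / 4 * (yt t x ^ 2 / sigW a b x + etaW a b x * yx t x ^ 2))
      (Ioc 0 1) := by fun_prop
  have key := hy.integral_multiplierDeriv_le h γ ht hε
  rw [integral_sub (hint _ (cm.fun_add c3)) (hint _ c2),
    integral_add (hint _ cm) (hint _ c3), integral_const_mul] at key
  have hq : IntegrableOn (fun x => yt t x ^ 2 / sigW a b x + etaW a b x * yx t x ^ 2)
      (Ioo 0 1) := (hy.integrableOn_yt ht.le).add (hy.integrableOn_yx h1 ht.le)
  have hsplit := setIntegral_Ioo_add hε hq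
  rw [integral_add (hy.integrableOn_yt ht.le) (hy.integrableOn_yx h1 ht.le)] at hsplit
  have hE := hy.energy_eq h1 ht.le
  set E := energy a b β y yt yx t with hE'
  have hX := integral_eta_mul_nonneg (a := a) (b := b) (yx t)
  have hV := h1.integral_yt_nonneg (yt t)
  have hyβ := mul_nonneg hβ (sq_nonneg (y t 1))
  have hE0 := hy.energy_nonneg h1 hβ ht.le
  have hZ2 := h1.profile_memH1sig0.l2sig.2
  have hcross : 2 * (∫ x in Ioo ε 1, γ * (yt t 1 * (profile a b x * yt t x)) / sigW a b x)
      ≤ B * δ * E + B * C / (2 * δ * m ^ 2) * yt t 1 ^ 2 := by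
    have hi : IntegrableOn (fun x => B * δ / 2 * (yt t x ^ 2 / sigW a b x)
        + B / (2 * δ) * yt t 1 ^ 2 * (profile a b x ^ 2 / sigW a b x)) (Ioo 0 1) :=
      ((hy.integrableOn_yt ht.le).const_mul _).add (hZ2.const_mul _)
    have hpos : ∀ x ∈ Ioo (0 : ℝ) 1, 0 < sigW a b x := fun x hx => h1.sigW_pos ⟨hx.1, hx.2.le⟩
    calc 2 * (∫ x in Ioo ε 1, γ * (yt t 1 * (profile a b x * yt t x)) / sigW a b x)
        = ∫ x in Ioo ε 1, 2 * (γ * (yt t 1 * (profile a b x * yt t x)) / sigW a b x) :=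
          (integral_const_mul _ _).symm
      _ ≤ ∫ x in Ioo ε 1, (B * δ / 2 * (yt t x ^ 2 / sigW a b x)
        + B / (2 * δ) * yt t 1 ^ 2 * (profile a b x ^ 2 / sigW a b x)) := by
          refine setIntegral_mono_on ((hint _ c2).const_mul 2)
            (hi.mono_set (Ioo_subset_Ioo hε.1.le le_rfl)) measurableSet_Ioo fun x hx => ?_
          have hs := hpos x ⟨hε.1.trans hx.1, hx.2⟩
          have k1 := (le_abs_self _).trans
            (abs_mul_le_young (u := c * (yt t 1 * profile a b x)) (v := yt t x) hδ)
          have k2 : (c * (yt t 1 * profile a b x)) ^ 2 / (2 * δ)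
              ≤ (yt t 1 * profile a b x) ^ 2 / (2 * δ) := by
            refine div_le_div_of_nonneg_right ?_ (by positivity)
            rw [mul_pow]
            exact mul_le_of_le_one_left (sq_nonneg _) (pow_le_one₀ hc0.le hc1)
          have k3 := mul_le_mul_of_nonneg_left (k1.trans (add_le_add_right k2 _)) hB0
          have k4 := div_le_div_of_nonneg_right k3 hs.le
          refine (le_of_eq ?_).trans (k4.trans (le_of_eq ?_))
          · rw [hγ']
            ring
          · ring
      _ ≤ ∫ x in Ioo (0 : ℝ) 1, (B * δ / 2 * (yt t x ^ 2 / sigW a b x)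
        + B / (2 * δ) * yt t 1 ^ 2 * (profile a b x ^ 2 / sigW a b x)) := by
          refine setIntegral_mono_set hi ?_
            (Ioo_subset_Ioo hε.1.le le_rfl : Ioo ε 1 ⊆ Ioo 0 1).eventuallyLE
          filter_upwards [ae_restrict_mem measurableSet_Ioo] with x hx
          have hs := hpos x hx
          simp only [Pi.zero_apply]
          positivity
      _ = B * δ / 2 * (∫ x in Ioo (0 : ℝ) 1, yt t x ^ 2 / sigW a b x)
          + B / (2 * δ) * yt t 1 ^ 2 * ∫ x in Ioo (0 : ℝ) 1, profile a b x ^ 2 / sigW a b x := by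
          rw [integral_add ((hy.integrableOn_yt ht.le).const_mul _) (hZ2.const_mul _),
            integral_const_mul, integral_const_mul]
      _ ≤ B * δ / 2 * (2 * E) + B / (2 * δ) * yt t 1 ^ 2 * (C / m ^ 2) := by
          refine add_le_add (mul_le_mul_of_nonneg_left (by linarith) (by positivity))
            (mul_le_mul_of_nonneg_left (h1.integral_profile_sq_le hC hHP) (by positivity))
      _ = B * δ * E + B * C / (2 * δ * m ^ 2) * yt t 1 ^ 2 := by
          field_simp
  have hcorner : -(B * c * N * (y t 1 * yt t 1))
      ≤ B * δ * E / m ^ 3 + B / (2 * δ) * yt t 1 ^ 2 := by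
    have k0 := hy.y_sq_le_energy h1 hβ ht.le (x := 1) (by simp)
    rw [one_mul] at k0
    have k1 := (neg_abs_le _).trans' (neg_le_neg
      (abs_mul_le_young (u := yt t 1) (v := c * N * y t 1) hδ))
    have k2 : c * N ≤ 1 / m := (mul_le_of_le_one_left hN0 hc1).trans hN1
    have k3 : (c * N * y t 1) ^ 2 ≤ (1 / m) ^ 2 * (2 * E / m) := by
      rw [mul_pow]
      exact mul_le_mul (pow_le_pow_left₀ (by positivity) k2 2) k0 (sq_nonneg _) (by positivity)
    have k4 : -(yt t 1 * (c * N * y t 1)) ≤ δ / 2 * ((1 / m) ^ 2 * (2 * E / m))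
        + yt t 1 ^ 2 / (2 * δ) := by
      have := mul_le_mul_of_nonneg_left k3 (by positivity : 0 ≤ δ / 2)
      linarith
    have k5 := mul_le_mul_of_nonneg_left k4 hB0
    refine (le_of_eq ?_).trans (k5.trans (le_of_eq ?_))
    · ring
    · field_simp
  have hbc : etaW a b 1 * yx t 1 = -(yt t 1 + β * y t 1) := by linarith [hy.bc1 t ht]
  have hcB : c * (1 + β * N) = 1 := by rw [hc]; field_simp
  have hflux : 2 * flux a b K γ y yt yx t 1 + ε₀ / 2 * (β * y t 1 ^ 2)
      ≤ (1 / sigW a b 1 + 1 / etaW a b 1 + β / etaW a b 1 + K / 4) * yt t 1 ^ 2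
        - B * c * N * (y t 1 * yt t 1) := by
    have k1 := boundary_flux_le (Y := y t 1) (V := yt t 1) hη1 hβ hK.le
    have k2 : 2 * flux a b K γ y yt yx t 1
        = yt t 1 ^ 2 / sigW a b 1 + ((yt t 1 + β * y t 1) ^ 2 / etaW a b 1
          + K / 2 * (y t 1 * (yt t 1 + β * y t 1)))
          - B * (c * (1 + β * N)) * y t 1 ^ 2 - B * c * N * (y t 1 * yt t 1) := by
      rw [flux, hbc, ← hN, hγ']
      ring
    have k3 : B * y t 1 ^ 2 = (β ^ 2 / etaW a b 1 + K * β / 2 + β / etaW a b 1 + K / 4)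
        * y t 1 ^ 2 + ε₀ / 2 * (β * y t 1 ^ 2) := by
      rw [hB]
      ring
    have k4 : (1 / sigW a b 1 + 1 / etaW a b 1 + β / etaW a b 1 + K / 4) * yt t 1 ^ 2
        = yt t 1 ^ 2 / sigW a b 1
          + (1 / etaW a b 1 + β / etaW a b 1 + K / 4) * yt t 1 ^ 2 := by
      ring
    rw [hcB, mul_one, k3] at k2
    rw [k4]
    linarith
  have hfin : δ * (B * (1 / m ^ 3 + 1)) * E = B * δ * E / m ^ 3 + B * δ * E := by ring
  have hsplit' := congrArg (ε₀ / 2 * ·) hsplit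
  have hE'' := congrArg (ε₀ / 2 * ·) hE
  simp only [mul_add] at hsplit' hE''
  rw [sub_mul, hfin]
  linarith

end Dissipation

lemma exists_slice_small {G : ℝ × ℝ → ℝ} {s T : ℝ}
    (hG : IntegrableOn G (Ioo s T ×ˢ Ioo (0 : ℝ) 1)) {τ : ℝ} (hτ : 0 < τ) :
    ∃ ε ∈ Ioo (0 : ℝ) 1, ε < τ ∧ IntegrableOn (fun t => G (t, ε)) (Ioo s T) ∧
      ε * (∫ t in Ioo s T, G (t, ε)) < τ ∧
      IntegrableOn (fun t => ∫ x in Ioo 0 ε, G (t, x)) (Ioo s T) ∧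
      ∫ t in Ioo s T, ∫ x in Ioo 0 ε, G (t, x) < τ := by
  have hprod : ∀ ε, (volume.restrict (Ioo s T)).prod (volume.restrict (Ioo (0 : ℝ) ε))
      = (volume : Measure (ℝ × ℝ)).restrict (Ioo s T ×ˢ Ioo 0 ε) := fun ε => by
    rw [Measure.prod_restrict, Measure.volume_eq_prod]
  have h1 : Integrable G
      ((volume.restrict (Ioo s T)).prod (volume.restrict (Ioo (0 : ℝ) 1))) := by
    rw [hprod]; exact hG
  have hev := (tendsto_order.1 (tendsto_setIntegral_Ioo_zero h1.integral_prod_right)).2 τ hτ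
  have hτ1 : ∀ᶠ ε in 𝓝[>] (0 : ℝ), ε ∈ Ioo 0 (min τ 1) := Ioo_mem_nhdsGT (by positivity)
  obtain ⟨ε, ⟨⟨hs, hlt⟩, hsm⟩, hε⟩ :=
    ((frequently_mul_lt h1.integral_prod_right h1.prod_left_ae hτ).and_eventually hev
      |>.and_eventually hτ1).exists
  have hε1 : ε < 1 := hε.2.trans_le (min_le_right _ _)
  have h2 : Integrable G
      ((volume.restrict (Ioo s T)).prod (volume.restrict (Ioo (0 : ℝ) ε))) := by
    rw [hprod]
    exact hG.mono_set (prod_mono le_rfl (Ioo_subset_Ioo le_rfl hε1.le))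
  refine ⟨ε, ⟨hε.1, hε1⟩, hε.2.trans_le (min_le_left _ _), hs, hlt, h2.integral_prod_left, ?_⟩
  rwa [integral_integral_swap (f := fun t x => G (t, x)) h2]

section Decay

variable {a a' b : ℝ → ℝ} {K β ε₀ B C δ γ Θ : ℝ} {y yt yx ytt ytx yxx : ℝ → ℝ → ℝ}

lemma abs_mul_le_mul {c d v r : ℝ} (hc : 0 ≤ c) (hcd : c ≤ d) (hv : |v| ≤ r) :
    |c * v| ≤ d * r := by
  rw [abs_mul, abs_of_nonneg hc]
  exact mul_le_mul hcd hv (abs_nonneg _) (hc.trans hcd)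

lemma ClassicalSol.abs_integral_multiplier_le
    (hy : ClassicalSol a b β y yt yx ytt ytx yxx) (h : HypH1 a a' b K) (hβ : 0 ≤ β)
    (hC : 0 ≤ C)
    (hHP : ∀ v v' : ℝ → ℝ, MemH1sig0 a b v v' →
      ∫ x in Ioo (0 : ℝ) 1, v x ^ 2 / sigW a b x ≤ C * ∫ x in Ioo (0 : ℝ) 1, v' x ^ 2)
    (hB : 0 ≤ B) (hγ : γ ∈ Icc 0 (B / 2))
    (hΘ₁ : 1 / a 1 + K * C / (4 * sInf (etaW a b '' Icc 0 1)) ≤ Θ) (hΘ₂ : 1 + K / 4 ≤ Θ)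
    {t ε : ℝ} (ht : 0 ≤ t) (hε : ε ∈ Ioo (0 : ℝ) 1) :
    |2 * ∫ x in Ioo ε 1, multiplier a b K γ y yt yx t x|
      ≤ (2 * Θ + B + B * C / sInf (etaW a b '' Icc 0 1) ^ 3) * energy a b β y yt yx t := by
  have hm := h.sInf_etaW.1
  have hK := h.K_mem.1
  set m := sInf (etaW a b '' Icc 0 1)
  have hE := hy.energy_eq h ht
  have hy1 := hy.y_sq_le_energy h hβ ht (x := 1) (by simp)
  have hE0 := hy.energy_nonneg h hβ ht
  set E := energy a b β y yt yx t
  have hX := integral_eta_mul_nonneg (a := a) (b := b) (yx t)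
  have hV := h.integral_yt_nonneg (yt t)
  have hyβ := mul_nonneg hβ (sq_nonneg (y t 1))
  have iV := hy.integrableOn_yt ht
  have iX := hy.integrableOn_yx h ht
  have iY := (hy.regx t ht).l2sig.2
  have iZ := h.profile_memH1sig0.l2sig.2
  have ha1 := h.pos 1 (by simp)
  set F : ℝ → ℝ := fun x => (1 + K / 4 + B / 2) * (yt t x ^ 2 / sigW a b x)
    + 1 / a 1 * (etaW a b x * yx t x ^ 2) + K / 4 * (y t x ^ 2 / sigW a b x)
    + B / 2 * y t 1 ^ 2 * (profile a b x ^ 2 / sigW a b x) with hF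
  have i1 := (iV.const_mul (1 + K / 4 + B / 2)).add (iX.const_mul (1 / a 1))
  have i2 := i1.add (iY.const_mul (K / 4))
  have iF : IntegrableOn F (Ioo 0 1) := i2.add (iZ.const_mul (B / 2 * y t 1 ^ 2))
  have hpt : ∀ x ∈ Ioo (0 : ℝ) 1, |2 * multiplier a b K γ y yt yx t x| ≤ F x := by
    intro x hx
    have hx' : x ∈ Ioc (0 : ℝ) 1 := ⟨hx.1, hx.2.le⟩
    have hs := h.sigW_pos hx'
    have hη := etaW_pos a b x
    have ha := h.pos x hx'
    have k1 : (x * yx t x) ^ 2 / sigW a b x ≤ 1 / a 1 * (etaW a b x * yx t x ^ 2) := by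
      have := mul_le_mul_of_nonneg_right (h.sq_mul_le hx')
        (by positivity : 0 ≤ etaW a b x * yx t x ^ 2)
      refine (le_of_eq ?_).trans this
      rw [sigW]
      field_simp
    have k2 : |2 * (x * (yx t x * yt t x) - K / 4 * (y t x * yt t x)
        + γ * (y t 1 * (profile a b x * yt t x)))|
        ≤ ((x * yx t x) ^ 2 + yt t x ^ 2) + K / 4 * (y t x ^ 2 + yt t x ^ 2)
          + B / 2 * (y t 1 ^ 2 * profile a b x ^ 2 + yt t x ^ 2) := by
      have e1 : |2 * ((x * yx t x) * yt t x)| ≤ (x * yx t x) ^ 2 + yt t x ^ 2 := by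
        rw [abs_le]
        constructor <;> nlinarith [sq_nonneg (x * yx t x - yt t x),
          sq_nonneg (x * yx t x + yt t x)]
      have e2 : |2 * (y t x * yt t x)| ≤ y t x ^ 2 + yt t x ^ 2 := by
        rw [abs_le]
        constructor <;> nlinarith [sq_nonneg (y t x - yt t x), sq_nonneg (y t x + yt t x)]
      have e3 : |2 * ((y t 1 * profile a b x) * yt t x)|
          ≤ y t 1 ^ 2 * profile a b x ^ 2 + yt t x ^ 2 := by
        rw [abs_le]
        constructor <;> nlinarith [sq_nonneg (y t 1 * profile a b x - yt t x),
          sq_nonneg (y t 1 * profile a b x + yt t x)]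
      have t1 := abs_le.1 e1
      have t2 := abs_le.1 (abs_mul_le_mul (by positivity : 0 ≤ K / 4) le_rfl e2)
      have t3 := abs_le.1 (abs_mul_le_mul hγ.1 hγ.2 e3)
      rw [abs_le]
      constructor <;> linarith [t1.1, t1.2, t2.1, t2.2, t3.1, t3.2]
    have k3 := div_le_div_of_nonneg_right k2 hs.le
    rw [multiplier, ← mul_div_assoc, abs_div, abs_of_pos hs]
    refine k3.trans (le_of_eq_of_le ?_ (add_le_add_right k1 ((1 + K / 4 + B / 2) *
      (yt t x ^ 2 / sigW a b x) + K / 4 * (y t x ^ 2 / sigW a b x)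
      + B / 2 * y t 1 ^ 2 * (profile a b x ^ 2 / sigW a b x))) |>.trans_eq ?_)
    · ring
    · rw [hF]; ring
  have hF0 : ∀ x ∈ Ioo (0 : ℝ) 1, 0 ≤ F x := fun x hx => (abs_nonneg _).trans (hpt x hx)
  have hsub : Ioo ε 1 ⊆ Ioo (0 : ℝ) 1 := Ioo_subset_Ioo hε.1.le le_rfl
  have b1 : |2 * ∫ x in Ioo ε 1, multiplier a b K γ y yt yx t x| ≤ ∫ x in Ioo (0 : ℝ) 1, F x := by
    rw [← integral_const_mul, ← Real.norm_eq_abs]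
    refine (norm_integral_le_of_norm_le (iF.mono_set hsub) ?_).trans
      (setIntegral_mono_set iF ?_ hsub.eventuallyLE)
    · filter_upwards [ae_restrict_mem measurableSet_Ioo] with x hx using hpt x (hsub hx)
    · filter_upwards [ae_restrict_mem measurableSet_Ioo] with x hx using hF0 x hx
  have b2 : ∫ x in Ioo (0 : ℝ) 1, F x
      = (1 + K / 4 + B / 2) * (∫ x in Ioo (0 : ℝ) 1, yt t x ^ 2 / sigW a b x)
        + 1 / a 1 * (∫ x in Ioo (0 : ℝ) 1, etaW a b x * yx t x ^ 2)
        + K / 4 * (∫ x in Ioo (0 : ℝ) 1, y t x ^ 2 / sigW a b x)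
        + B / 2 * y t 1 ^ 2 * ∫ x in Ioo (0 : ℝ) 1, profile a b x ^ 2 / sigW a b x := by
    rw [hF, integral_add (by exact i2) (iZ.const_mul _), integral_add (by exact i1)
      (iY.const_mul _), integral_add (iV.const_mul _) (iX.const_mul _)]
    simp only [integral_const_mul]
  have b3 : ∫ x in Ioo (0 : ℝ) 1, y t x ^ 2 / sigW a b x
      ≤ C * ((∫ x in Ioo (0 : ℝ) 1, etaW a b x * yx t x ^ 2) / m) :=
    (hHP _ _ ⟨(hy.regx t ht).toMemH1sig, (hy.regx t ht).zero⟩).trans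
      (mul_le_mul_of_nonneg_left (hy.integral_yx_sq_le h ht) hC)
  have b4 : y t 1 ^ 2 * (∫ x in Ioo (0 : ℝ) 1, profile a b x ^ 2 / sigW a b x)
      ≤ 2 * E / m * (C / m ^ 2) := by
    rw [one_mul] at hy1
    exact mul_le_mul hy1 (h.integral_profile_sq_le hC hHP) (h.integral_yt_nonneg _)
      (by positivity)
  set X := ∫ x in Ioo (0 : ℝ) 1, etaW a b x * yx t x ^ 2
  set V := ∫ x in Ioo (0 : ℝ) 1, yt t x ^ 2 / sigW a b x
  have c1 := mul_le_mul_of_nonneg_left b3 (by positivity : 0 ≤ K / 4)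
  have c2 := mul_le_mul_of_nonneg_left b4 (by positivity : 0 ≤ B / 2)
  have c3 := mul_le_mul_of_nonneg_right hΘ₁ hX
  have c4 := mul_le_mul_of_nonneg_right hΘ₂ hV
  have hΘ0 : 0 ≤ Θ := by linarith
  have c5 : Θ * X + Θ * V ≤ Θ * (2 * E) := by
    rw [← mul_add]
    exact mul_le_mul_of_nonneg_left (by linarith) hΘ0
  have c6 : B / 2 * V ≤ B / 2 * (2 * E) := mul_le_mul_of_nonneg_left (by linarith) (by positivity)
  have c7 : K / 4 * (C * (X / m)) = K * C / (4 * m) * X := by field_simp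
  have c8 : B / 2 * (2 * E / m * (C / m ^ 2)) = B * C / m ^ 3 * E := by field_simp
  rw [b2] at b1
  linarith

lemma ClassicalSol.neg_flux_le (hy : ClassicalSol a b β y yt yx ytt ytx yxx)
    (h : HypH1 a a' b K) (hβ : 0 ≤ β) (hγ : 0 ≤ γ) {D : ℝ} {t ε ρ : ℝ} (ht : 0 ≤ t)
    (hD : 2 * energy a b β y yt yx t / sInf (etaW a b '' Icc 0 1) ≤ D)
    (hε : ε ∈ Ioo (0 : ℝ) 1) (hρ : 0 < ρ) (hερ : ε ≤ ρ ^ 2) :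
    -(2 * flux a b K γ y yt yx t ε)
      ≤ (K / 4 + γ / sInf (etaW a b '' Icc 0 1) + 2 * γ)
        * ((sSup (etaW a b '' Icc 0 1) + 1) * D * ρ
          + ε * (yt t ε ^ 2 / sigW a b ε + etaW a b ε * yx t ε ^ 2) / ρ) := by
  have hε' : ε ∈ Ioc (0 : ℝ) 1 := ⟨hε.1, hε.2.le⟩
  have hεI := Ioc_subset_Icc_self hε'
  have hm := h.sInf_etaW.1
  have hK := h.K_mem.1
  have hη := etaW_pos a b ε
  have hσ := h.sigW_pos hε'
  have hηS := h.le_sSup_etaW hεI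
  have hZ := h.profile_mem hεI
  have hyε := (hy.y_sq_le_energy h hβ ht hεI).trans (mul_le_mul_of_nonneg_left hD hε.1.le)
  have hy1 := hy.y_sq_le_energy h hβ ht (x := 1) (by simp)
  have hE0 := hy.energy_nonneg h hβ ht
  set m := sInf (etaW a b '' Icc 0 1)
  set S := sSup (etaW a b '' Icc 0 1)
  set η := etaW a b ε
  have hS : 0 < S := hη.trans_le hηS
  have hD0 : 0 ≤ D := le_trans (by positivity) hD
  rw [one_mul] at hy1
  replace hy1 := hy1.trans hD
  set p := η * yx t ε with hp
  set u := ε * (yt t ε ^ 2 / sigW a b ε + η * yx t ε ^ 2) with hu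
  have hεne := hε.1
  have hpu : ε * p ^ 2 ≤ S * u := by
    have e1 : ε * p ^ 2 = η * (ε * (η * yx t ε ^ 2)) := by rw [hp]; ring
    rw [e1]
    refine mul_le_mul hηS ?_ (by positivity) hS.le
    rw [hu]
    exact mul_le_mul_of_nonneg_left (le_add_of_nonneg_left (by positivity)) hε.1.le
  have hu0 : 0 ≤ u := by rw [hu]; positivity
  set R := (S + 1) * D * ρ + u / ρ with hR
  have hpρ : ε * p ^ 2 / (ρ * S) ≤ u / ρ := by
    rw [div_le_div_iff₀ (by positivity) hρ]
    nlinarith [mul_le_mul_of_nonneg_right hpu hρ.le]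
  have hDρ : 0 ≤ D * ρ := by positivity
  have hSDρ : 0 ≤ S * D * ρ := by positivity
  have huρ : 0 ≤ u / ρ := by positivity
  have hR' : R = S * D * ρ + D * ρ + u / ρ := by rw [hR]; ring
  have j1 : 2 * |y t ε * p| ≤ R := by
    have k1 := abs_mul_le_young (u := p) (v := y t ε) (r := ρ * S / ε) (by positivity)
    rw [mul_comm p] at k1
    have k2 := mul_le_mul_of_nonneg_left hyε (by positivity : 0 ≤ ρ * S / ε)
    have k3 : ρ * S / ε * (ε * D) = S * D * ρ := by field_simp
    have k4 : p ^ 2 / (2 * (ρ * S / ε)) = (ε * p ^ 2 / (ρ * S)) / 2 := by field_simp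
    linarith
  have j2 : 2 * (|y t 1| * (profile a b ε * |p|)) ≤ R / m := by
    have k1 := abs_mul_le_young (u := p) (v := y t 1) (r := ρ * S) (by positivity)
    have k2 := mul_le_mul_of_nonneg_left hy1 (by positivity : 0 ≤ ρ * S)
    have k3 := mul_le_mul_of_nonneg_left k1 hε.1.le
    have k4 : ε * (p ^ 2 / (2 * (ρ * S))) = (ε * p ^ 2 / (ρ * S)) / 2 := by field_simp
    have k5 : ε * (ρ * S * y t 1 ^ 2) ≤ 1 * (S * D * ρ) :=
      mul_le_mul hε.2.le (by linarith) (by positivity) zero_le_one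
    have k6 : 2 * (ε * |p * y t 1|) ≤ R := by linarith
    have k7 : profile a b ε * (|p| * |y t 1|) ≤ ε / m * (|p| * |y t 1|) :=
      mul_le_mul_of_nonneg_right hZ.2 (by positivity)
    rw [le_div_iff₀ hm]
    rw [div_mul_eq_mul_div, le_div_iff₀ hm, ← abs_mul] at k7
    rw [abs_mul] at k6 k7
    linarith
  have j3 : 2 * |y t 1 * y t ε| ≤ 2 * R := by
    have k1 := abs_mul_le_young (u := y t ε) (v := y t 1) hρ
    rw [mul_comm (y t ε)] at k1
    have k2 : y t ε ^ 2 / (2 * ρ) ≤ D * ρ / 2 := by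
      rw [div_le_iff₀ (by positivity)]
      nlinarith [mul_le_mul_of_nonneg_right hερ hD0]
    have k3 := mul_le_mul_of_nonneg_left hy1 hρ.le
    linarith
  have j4 : |y t 1 * (profile a b ε * p)| = |y t 1| * (profile a b ε * |p|) := by
    rw [abs_mul, abs_mul, abs_of_nonneg hZ.1]
  have l1 := mul_le_mul_of_nonneg_left ((mul_le_mul_of_nonneg_left (le_abs_self _)
    zero_le_two).trans j1) (by positivity : 0 ≤ K / 4)
  have l2 : γ * -(R / m) ≤ γ * (2 * (y t 1 * (profile a b ε * p))) := by
    refine mul_le_mul_of_nonneg_left ?_ hγ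
    linarith [neg_abs_le (y t 1 * (profile a b ε * p))]
  have l3 := mul_le_mul_of_nonneg_left ((mul_le_mul_of_nonneg_left (le_abs_self _)
    zero_le_two).trans j3) hγ
  have q1 : 0 ≤ ε * yt t ε ^ 2 / sigW a b ε := by positivity
  have q2 : 0 ≤ ε * p ^ 2 / η := by positivity
  have hfl : flux a b K γ y yt yx t ε = 1 / 2 * (ε * yt t ε ^ 2 / sigW a b ε)
      + 1 / 2 * (ε * p ^ 2 / η) - K / 4 * (y t ε * p)
      + γ * (y t 1 * (profile a b ε * p)) - γ * (y t 1 * y t ε) := by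
    rw [flux]; ring
  have hRm : γ * (R / m) = γ / m * R := by ring
  linarith

end Decay

lemma le_of_forall_le_add_mul {X Y c : ℝ} (h : ∀ ρ, 0 < ρ → ρ < 1 → X ≤ Y + c * ρ) : X ≤ Y := by
  have h1 : Tendsto (fun ρ => Y + c * ρ) (𝓝[>] 0) (𝓝 (Y + c * 0)) :=
    ((continuous_const.add (continuous_const.mul continuous_id)).tendsto 0).mono_left
      nhdsWithin_le_nhds
  rw [mul_zero, add_zero] at h1
  refine ge_of_tendsto h1 ?_
  filter_upwards [Ioo_mem_nhdsGT (zero_lt_one (α := ℝ))] with ρ hρ using h ρ hρ.1 hρ.2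

section IntegralEstimate

variable {a a' b : ℝ → ℝ} {K β ε₀ B C δ Θ : ℝ} {y yt yx ytt ytx yxx : ℝ → ℝ → ℝ}

lemma ClassicalSol.integral_energy_le (hy : ClassicalSol a b β y yt yx ytt ytx yxx)
    (h : HypH2 a a' b K ε₀) (hβ : 0 ≤ β) (hC : 0 ≤ C)
    (hHP : ∀ v v' : ℝ → ℝ, MemH1sig0 a b v v' →
      ∫ x in Ioo (0 : ℝ) 1, v x ^ 2 / sigW a b x ≤ C * ∫ x in Ioo (0 : ℝ) 1, v' x ^ 2)
    (hB : B = β ^ 2 / etaW a b 1 + K * β / 2 + β / etaW a b 1 + K / 4 + β * ε₀ / 2)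
    (hδ : 0 < δ)
    (hΘ₁ : 1 / a 1 + K * C / (4 * sInf (etaW a b '' Icc 0 1)) ≤ Θ) (hΘ₂ : 1 + K / 4 ≤ Θ)
    (s T : ℝ) (hs : 0 < s) (hsT : s < T) :
    (ε₀ - δ * (B * (1 / sInf (etaW a b '' Icc 0 1) ^ 3 + 1)))
        * ∫ t in s..T, energy a b β y yt yx t
      ≤ (2 * (2 * Θ + B + B * C / sInf (etaW a b '' Icc 0 1) ^ 3)
        + (1 / sigW a b 1 + 1 / etaW a b 1 + β / etaW a b 1 + K / 4 + B / (2 * δ)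
          + B * C / (2 * δ * sInf (etaW a b '' Icc 0 1) ^ 2))) * energy a b β y yt yx s := by
  have h1 := h.1
  have hε₀ := h.2.1
  have hK := h1.K_mem.1
  have hη1 := etaW_pos a b 1
  have hσ1 := h1.sigW_pos (x := 1) (by simp)
  have hm := h1.sInf_etaW.1
  have hN := (h1.profile_mem (x := 1) (by simp)).1
  have hB0 : 0 ≤ B := by rw [hB]; positivity
  have hβN : 1 ≤ 1 + β * profile a b 1 := le_add_of_nonneg_right (mul_nonneg hβ hN)
  set γ := B / 2 / (1 + β * profile a b 1) with hγ'
  have hγ : γ ∈ Icc 0 (B / 2) := ⟨by positivity, div_le_self (by positivity) hβN⟩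
  have hΘ0 : 0 ≤ Θ := le_trans (by positivity) hΘ₂
  set E := energy a b β y yt yx with hE
  set m := sInf (etaW a b '' Icc 0 1) with hm'
  set S := sSup (etaW a b '' Icc 0 1) with hS'
  set κ := ε₀ - δ * (B * (1 / m ^ 3 + 1)) with hκ
  set Q := 2 * Θ + B + B * C / m ^ 3 with hQ
  set P := 1 / sigW a b 1 + 1 / etaW a b 1 + β / etaW a b 1 + K / 4 + B / (2 * δ)
          + B * C / (2 * δ * m ^ 2) with hP
  set k := K / 4 + γ / m + 2 * γ with hk
  set D := 2 * E s / m with hD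
  have hQ0 : 0 ≤ Q := by positivity
  have hP0 : 0 ≤ P := by positivity
  have hk0 : 0 ≤ k := by have := hγ.1; positivity
  have hanti := hy.energy_antitoneOn h1
  have hEs : ∀ t ∈ Icc s T, E t ≤ E s := fun t ht =>
    hanti (mem_Ici.2 hs.le) (mem_Ici.2 (hs.le.trans ht.1)) ht.1
  have hET := hy.energy_nonneg h1 hβ (hs.trans hsT).le
  set G : ℝ × ℝ → ℝ := fun p => yt p.1 p.2 ^ 2 / sigW a b p.2 + etaW a b p.2 * yx p.1 p.2 ^ 2
    with hG
  have iG : IntegrableOn G (Ioo s T ×ˢ Ioo (0 : ℝ) 1) :=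
    (hy.intQ s T hs hsT).1.add (hy.intQ s T hs hsT).2
  refine le_of_forall_le_add_mul
    (c := ε₀ / 2 + k * ((S + 1) * D * (T - s)) + k) fun ρ hρ hρ1 => ?_
  obtain ⟨ε, hε, hερ, is, hslice, ii, hstrip⟩ := exists_slice_small iG (τ := ρ ^ 2) (by positivity)
  set φ : ℝ → ℝ := fun t => -κ * E t + ε₀ / 2 * (∫ x in Ioo 0 ε, G (t, x))
    + k * ((S + 1) * D * ρ + ε * G (t, ε) / ρ) with hφ
  have cE : ContinuousOn E (Icc s T) :=
    hy.energy_continuousOn.mono fun t ht => mem_Ici.2 (hs.le.trans ht.1)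
  have iE : IntervalIntegrable E volume s T := cE.intervalIntegrable_of_Icc hsT.le
  have is' : IntervalIntegrable (fun t => G (t, ε)) volume s T :=
    intervalIntegrable_of_Ioo hsT.le is
  have ii' : IntervalIntegrable (fun t => ∫ x in Ioo 0 ε, G (t, x)) volume s T :=
    intervalIntegrable_of_Ioo hsT.le ii
  have ic : IntervalIntegrable (fun _ : ℝ => (S + 1) * D * ρ) volume s T :=
    intervalIntegrable_const
  have j1 := iE.const_mul (-κ)
  have j2 := ii'.const_mul (ε₀ / 2)
  have j3 : IntervalIntegrable (fun t => ε * G (t, ε) / ρ) volume s T :=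
    (is'.const_mul ε).div_const ρ
  have j4 : IntervalIntegrable (fun t => k * ((S + 1) * D * ρ + ε * G (t, ε) / ρ)) volume s T :=
    (ic.add j3).const_mul k
  have iφ : IntervalIntegrable φ volume s T := (j1.add j2).add j4
  have hφint : ∫ t in s..T, φ t = -κ * (∫ t in s..T, E t)
      + ε₀ / 2 * (∫ t in Ioo s T, ∫ x in Ioo 0 ε, G (t, x))
      + k * ((S + 1) * D * (T - s) * ρ + ε * (∫ t in Ioo s T, G (t, ε)) / ρ) := by
    rw [hφ, intervalIntegral.integral_add (by exact j1.add j2) j4,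
      intervalIntegral.integral_add j1 j2, intervalIntegral.integral_const_mul,
      intervalIntegral.integral_const_mul, intervalIntegral.integral_const_mul,
      intervalIntegral.integral_add ic j3, intervalIntegral.integral_div,
      intervalIntegral.integral_const_mul ε, intervalIntegral.integral_const,
      setIntegral_Ioo_eq_intervalIntegral hsT.le, setIntegral_Ioo_eq_intervalIntegral hsT.le,
      smul_eq_mul]
    ring
  set W : ℝ → ℝ := fun t => 2 * ∫ x in Ioo ε 1, multiplier a b K γ y yt yx t x with hW
  have hder : ∀ t, 0 < t → HasDerivAt (fun t => W t + P * E t)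
      (2 * (∫ x in Ioo ε 1, multiplierDeriv a b K γ y yt yx ytt ytx t x)
        + P * -(yt t 1) ^ 2) t := fun t ht =>
    ((hy.integral_multiplier_hasDerivAt h1 γ ht hε).const_mul 2).add
      ((hy.energy_hasDerivAt h1 ht).const_mul P)
  have hmain := intervalIntegral.sub_le_integral_of_hasDeriv_right_of_le hsT.le
    (fun t ht => (hder t (hs.trans_le ht.1)).continuousAt.continuousWithinAt)
    (fun t ht => (hder t (hs.trans ht.1)).hasDerivWithinAt)
    ((intervalIntegrable_iff_integrableOn_Icc_of_le hsT.le).1 iφ) (fun t ht => by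
      have ht0 := hs.trans ht.1
      have k1 := hy.integral_multiplierDeriv_sub_le h hβ hC hHP hB hδ ht0 hε
      have k2 := hy.neg_flux_le h1 hβ hγ.1 ht0.le (D := D)
        (div_le_div_of_nonneg_right (mul_le_mul_of_nonneg_left
          (hEs t ⟨ht.1.le, ht.2.le⟩) zero_le_two) hm.le) hε hρ hερ.le
      rw [← hγ', ← hm', ← hP, ← hκ, ← hE] at k1
      rw [← hm', ← hS', ← hk] at k2
      simp only [hφ, hG]
      linarith)
  have hWb : ∀ t ∈ Icc s T, |W t| ≤ Q * E s := fun t ht =>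
    (hy.abs_integral_multiplier_le h1 hβ hC hHP hB0 hγ hΘ₁ hΘ₂ (hs.le.trans ht.1) hε).trans
      (mul_le_mul_of_nonneg_left (hEs t ht) hQ0)
  have w1 := (abs_le.1 (hWb T ⟨hsT.le, le_rfl⟩)).1
  have w2 := (abs_le.1 (hWb s ⟨le_rfl, hsT.le⟩)).2
  rw [hφint] at hmain
  have r1 : ε₀ / 2 * (∫ t in Ioo s T, ∫ x in Ioo 0 ε, G (t, x)) ≤ ε₀ / 2 * ρ :=
    mul_le_mul_of_nonneg_left (hstrip.le.trans (by nlinarith)) (by positivity)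
  have r2 : k * (ε * (∫ t in Ioo s T, G (t, ε)) / ρ) ≤ k * ρ := by
    refine mul_le_mul_of_nonneg_left ?_ hk0
    rw [div_le_iff₀ hρ, ← sq]
    exact hslice.le
  have r3 := mul_nonneg hP0 hET
  linarith

end IntegralEstimate

/-- Exponential decay of the energy (Theorem 3.7). -/
theorem stmt18 (a a' b : ℝ → ℝ) (K β C_HP ε₀ Θ C₁ : ℝ)
    (y yt yx ytt ytx yxx : ℝ → ℝ → ℝ)
    (hH2 : HypH2 a a' b K ε₀) (hβ : 0 ≤ β) (hC_HP : 0 < C_HP)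
    (hHP : ∀ v v' : ℝ → ℝ, MemH1sig0 a b v v' →
      ∫ x in Set.Ioo (0:ℝ) 1, (v x) ^ 2 / sigW a b x ≤
        C_HP * ∫ x in Set.Ioo (0:ℝ) 1, (v' x) ^ 2)
    (hΘ : Θ = max (1 / a 1 + K * C_HP / sInf (etaW a b '' Set.Icc 0 1)) (1 + K / 4))
    (hC₁ : C₁ = (β ^ 2 / etaW a b 1 + K * β / 2 + β / etaW a b 1 + K / 4 + β * ε₀ / 2) *
      (1 / (sInf (etaW a b '' Set.Icc 0 1)) ^ 3 + 1))
    (hy : ClassicalSol a b β y yt yx ytt ytx yxx) :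
    ∀ δ : ℝ, 0 < δ → δ < ε₀ / (2 * C₁) →
      ∀ M : ℝ,
        M = (1 / (ε₀ - 2 * δ * C₁)) *
          (4 * Θ + 1 / sigW a b 1 + 1 / etaW a b 1 + β / etaW a b 1 + K / 4
            + (β ^ 2 / etaW a b 1 + K * β / 2 + β / etaW a b 1 + K / 4 + β * ε₀ / 2) *
              (2 + 2 * C_HP / (sInf (etaW a b '' Set.Icc 0 1)) ^ 3 + 1 / δ
                + (1 / δ) * (sSup (etaW a b '' Set.Icc 0 1) + C_HP)
                  / (sInf (etaW a b '' Set.Icc 0 1)) ^ 2)) →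
        ∀ t : ℝ, 0 < t →
          energy a b β y yt yx t ≤
            energy a b β y yt yx 0 * Real.exp (1 - t / M) := by
  have h1 := hH2.1
  have hε₀ := hH2.2.1
  have hK := h1.K_mem.1
  have hη1 := etaW_pos a b 1
  have hσ1 := h1.sigW_pos (x := 1) (by simp)
  have ha1 := h1.pos 1 (by simp)
  have hm := h1.sInf_etaW.1
  have hS : 0 ≤ sSup (etaW a b '' Icc 0 1) := hη1.le.trans (h1.le_sSup_etaW (by simp))
  have hN := (h1.profile_mem (x := 1) (by simp)).1
  intro δ hδ hδ' M hM t ht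
  have hint := hy.integral_energy_le hH2 hβ hC_HP.le hHP rfl hδ (Θ := Θ)
    (by
      refine le_trans (add_le_add_right ?_ _) ((le_max_left _ _).trans_eq hΘ.symm)
      refine div_le_div_of_nonneg_left (by positivity) hm ?_
      linarith)
    ((le_max_right _ _).trans_eq hΘ.symm)
  have hΘ1 : 1 + K / 4 ≤ Θ := (le_max_right _ _).trans_eq hΘ.symm
  have hΘ0 : 0 < Θ := lt_of_lt_of_le (by positivity) hΘ1
  rw [← hC₁] at hint
  set m := sInf (etaW a b '' Icc 0 1)
  set S := sSup (etaW a b '' Icc 0 1)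
  have hB0 : 0 < β ^ 2 / etaW a b 1 + K * β / 2 + β / etaW a b 1 + K / 4 + β * ε₀ / 2 := by
    positivity
  set B := β ^ 2 / etaW a b 1 + K * β / 2 + β / etaW a b 1 + K / 4 + β * ε₀ / 2
  have hC0 : 0 < C₁ := by rw [hC₁]; positivity
  have hκ : 0 < ε₀ - 2 * δ * C₁ := by
    rw [lt_div_iff₀ (by positivity)] at hδ'
    linarith
  set A := 4 * Θ + 1 / sigW a b 1 + 1 / etaW a b 1 + β / etaW a b 1 + K / 4
    + B * (2 + 2 * C_HP / m ^ 3 + 1 / δ + 1 / δ * (S + C_HP) / m ^ 2) with hA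
  have hA0 : 0 < A := by positivity
  have hM0 : 0 < M := by rw [hM]; positivity
  refine decay_of_integral_le hM0 hy.energy_continuousOn (hy.energy_antitoneOn h1)
    (fun t ht => hy.energy_nonneg h1 hβ ht) (fun s T hs hsT => ?_) ht
  have hEs := hy.energy_nonneg h1 hβ hs.le
  have hI : 0 ≤ ∫ t in s..T, energy a b β y yt yx t :=
    intervalIntegral.integral_nonneg hsT.le fun t ht => hy.energy_nonneg h1 hβ (hs.le.trans ht.1)
  rw [hM, one_div_mul_eq_div, div_mul_eq_mul_div, le_div_iff₀ hκ, mul_comm]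
  calc (ε₀ - 2 * δ * C₁) * ∫ t in s..T, energy a b β y yt yx t
      ≤ (ε₀ - δ * C₁) * ∫ t in s..T, energy a b β y yt yx t :=
        mul_le_mul_of_nonneg_right (by linarith [mul_pos hδ hC0]) hI
    _ ≤ _ := hint s T hs hsT
    _ ≤ A * energy a b β y yt yx s := by
        refine mul_le_mul_of_nonneg_right ?_ hEs
        have e1 : A - (2 * (2 * Θ + B + B * C_HP / m ^ 3)
            + (1 / sigW a b 1 + 1 / etaW a b 1 + β / etaW a b 1 + K / 4 + B / (2 * δ)
              + B * C_HP / (2 * δ * m ^ 2)))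
            = B / (2 * δ) + B * C_HP / (2 * δ * m ^ 2) + B * S / (δ * m ^ 2) := by
          rw [hA]
          field_simp
          ring
        have e2 : 0 ≤ B / (2 * δ) + B * C_HP / (2 * δ * m ^ 2) + B * S / (δ * m ^ 2) := by
          positivity
        linarith
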